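/- arXiv:1904.05307 — 2 statements merged into one kernel-verified Lean document; each statement's English description precedes it below -/
import Mathlib

section
/- Let 0 < p < 1 be fixed. A.a.s., for every integer d in the interval [(n−1)p − √((1/5)·n·ln n·p(1−p)), (n−1)p + √((1/5)·n·ln n·p(1−p))], the random graph G(n,p) contains at least n^{3/10}/ln²n vertices of degree exactly d. -/
open Classical Finset Filter

noncomputable def grWeight (n : ℕ) (p : ℝ) (G : SimpleGraph (Fin n)) : ℝ :=
  p ^ G.edgeFinset.card * (1 - p) ^ (n.choose 2 - G.edgeFinset.card)

noncomputable def grPr (n : ℕ) (p : ℝ) (A : Set (SimpleGraph (Fin n))) : ℝ :=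
  ∑ G : SimpleGraph (Fin n), if G ∈ A then grWeight n p G else 0

noncomputable def bw (p : ℝ) (b : Bool) : ℝ := if b then p else 1 - p

noncomputable def bW {ι : Type*} [Fintype ι] (p : ℝ) (f : ι → Bool) : ℝ := ∏ i, bw p (f i)

lemma bW_nonneg {ι : Type*} [Fintype ι] {p : ℝ} (hp0 : 0 < p) (hp1 : p < 1) (f : ι → Bool) :
    0 ≤ bW p f := by
  unfold bW bw
  refine Finset.prod_nonneg fun i _ => ?_
  split_ifs <;> linarith

lemma bW_prod {ι : Type*} [Fintype ι] [DecidableEq ι] (p : ℝ) (φ : ι → Bool → ℝ) :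
    ∑ f : ι → Bool, bW p f * ∏ i, φ i (f i) = ∏ i, (p * φ i true + (1 - p) * φ i false) := by
  have h := Finset.prod_univ_sum (fun _ : ι => (Finset.univ : Finset Bool))
    (fun i b => bw p b * φ i b)
  rw [Fintype.piFinset_univ] at h
  simp only [Fintype.sum_bool] at h
  simp only [bw, if_true, Bool.false_eq_true, if_false] at h
  rw [h]
  refine Finset.sum_congr rfl fun f _ => ?_
  rw [bW, ← Finset.prod_mul_distrib]
  rfl

lemma bW_sum {ι : Type*} [Fintype ι] [DecidableEq ι] (p : ℝ) : ∑ f : ι → Bool, bW p f = 1 := by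
  have := bW_prod (ι := ι) p (fun _ _ => 1)
  simpa using this

lemma bW_eq {ι : Type*} [Fintype ι] (p : ℝ) (f : ι → Bool) :
    bW p f = p ^ (univ.filter (fun i => f i = true)).card *
      (1 - p) ^ (Fintype.card ι - (univ.filter (fun i => f i = true)).card) := by
  unfold bW bw
  rw [Finset.prod_ite, Finset.prod_const, Finset.prod_const]
  congr 2
  have := Finset.card_filter_add_card_filter_not (s := (univ : Finset ι)) (fun i => f i = true)
  rw [Finset.card_univ] at this
  omega

lemma bW_count {ι : Type*} [Fintype ι] [DecidableEq ι] (p : ℝ) (φ : ℕ → ℝ) :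
    ∑ f : ι → Bool, bW p f * φ (univ.filter (fun i => f i = true)).card =
    ∑ k ∈ range (Fintype.card ι + 1),
      ((Fintype.card ι).choose k : ℝ) * p ^ k * (1 - p) ^ (Fintype.card ι - k) * φ k := by
  have h := Finset.sum_powerset_apply_card
    (x := (univ : Finset ι)) (fun k => p ^ k * (1 - p) ^ (Fintype.card ι - k) * φ k)
  rw [Finset.card_univ] at h
  have h2 : ∑ f : ι → Bool, bW p f * φ (univ.filter (fun i => f i = true)).card =
      ∑ s ∈ (univ : Finset ι).powerset,
        p ^ s.card * (1 - p) ^ (Fintype.card ι - s.card) * φ s.card := by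
    refine Finset.sum_nbij' (fun f => univ.filter (fun i => f i = true))
      (fun s i => decide (i ∈ s)) ?_ ?_ ?_ ?_ ?_
    · simp
    · simp
    · intro f _; ext i; simp
    · intro s _; ext i; simp
    · intro f _; simp only [bW_eq]
  rw [h2, h]
  refine Finset.sum_congr rfl fun k _ => ?_
  rw [nsmul_eq_mul]; ring

noncomputable def mrg {ι κ : Type*} (j : κ → ι) (h : κ → Bool)
    (g : ↥(Set.range j)ᶜ → Bool) (i : ι) : Bool :=
  if hi : i ∈ Set.range j then h hi.choose else g ⟨i, hi⟩

lemma mrg_apply {ι κ : Type*} (j : κ → ι) (hj : Function.Injective j) (h : κ → Bool)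
    (g : ↥(Set.range j)ᶜ → Bool) (k : κ) : mrg j h g (j k) = h k := by
  have hi : j k ∈ Set.range j := ⟨k, rfl⟩
  unfold mrg
  rw [dif_pos hi]
  exact congrArg h (hj hi.choose_spec)

lemma mrg_not {ι κ : Type*} (j : κ → ι) (h : κ → Bool)
    (g : ↥(Set.range j)ᶜ → Bool) (i : ι) (hi : i ∉ Set.range j) :
    mrg j h g i = g ⟨i, hi⟩ := by
  unfold mrg
  rw [dif_neg hi]

lemma bW_mrg {ι κ : Type*} [Fintype ι] [Fintype κ] (p : ℝ) (j : κ → ι)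
    [Fintype ↥(Set.range j)ᶜ]
    (hj : Function.Injective j) (h : κ → Bool) (g : ↥(Set.range j)ᶜ → Bool) :
    bW p (mrg j h g) = bW p h * bW p g := by
  unfold bW
  have e : (κ ⊕ ↥(Set.range j)ᶜ) ≃ ι :=
    (Equiv.sumCongr (Equiv.ofInjective j hj) (Equiv.refl _)).trans (Equiv.Set.sumCompl _)
  rw [← Fintype.prod_equiv ((Equiv.sumCongr (Equiv.ofInjective j hj) (Equiv.refl _)).trans
    (Equiv.Set.sumCompl (Set.range j))) (fun x => bw p (Sum.elim h g x)) _ ?_]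
  · rw [Fintype.prod_sum_type]; simp
  · rintro (x | x)
    · simp [mrg_apply j hj]
    · simp [mrg_not j h g x.1 x.2]

lemma bW_split {ι κ : Type*} [Fintype ι] [DecidableEq ι] [Fintype κ] [DecidableEq κ] (p : ℝ) (j : κ → ι)
    (hj : Function.Injective j) (F : (ι → Bool) → ℝ) :
    ∑ f : ι → Bool, bW p f * F f =
    ∑ g : ↥(Set.range j)ᶜ → Bool, bW p g * ∑ h : κ → Bool, bW p h * F (mrg j h g) := by
  have : ∑ g : ↥(Set.range j)ᶜ → Bool, bW p g * ∑ h : κ → Bool, bW p h * F (mrg j h g) =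
    ∑ x : (↥(Set.range j)ᶜ → Bool) × (κ → Bool), bW p (mrg j x.2 x.1) * F (mrg j x.2 x.1) := by
    rw [Fintype.sum_prod_type]
    refine Finset.sum_congr rfl fun g _ => ?_
    rw [Finset.mul_sum]
    refine Finset.sum_congr rfl fun h _ => ?_
    rw [bW_mrg p j hj]; ring
  rw [this]
  symm
  refine Finset.sum_nbij' (fun x => mrg j x.2 x.1) (fun f => (fun i => f i.1, fun k => f (j k)))
    ?_ ?_ ?_ ?_ ?_
  · simp
  · simp
  · rintro ⟨g, h⟩ _
    ext x
    · simp [mrg_not j h g x.1 x.2]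
    · simp [mrg_apply j hj]
  · intro f _
    ext i
    by_cases hi : i ∈ Set.range j
    · obtain ⟨k, rfl⟩ := hi
      simp [mrg_apply j hj]
    · simp [mrg_not _ _ _ i hi]
  · intro x _; rfl

/-- marginal -/
lemma bW_marg {ι κ : Type*} [Fintype ι] [DecidableEq ι] [Fintype κ] [DecidableEq κ] (p : ℝ) (j : κ → ι)
    (hj : Function.Injective j) (φ : ℕ → ℝ) :
    ∑ f : ι → Bool, bW p f * φ (univ.filter (fun k => f (j k) = true)).card =
    ∑ k ∈ range (Fintype.card κ + 1),
      ((Fintype.card κ).choose k : ℝ) * p ^ k * (1 - p) ^ (Fintype.card κ - k) * φ k := by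
  rw [bW_split p j hj]
  simp only [mrg_apply j hj]
  simp only [bW_count]
  rw [← Finset.sum_mul, bW_sum, one_mul]

/-- rows -/
lemma bW_rows {α β : Type*} [Fintype α] [DecidableEq α] [Fintype β] [DecidableEq β] (p : ℝ) (φ : α → ℕ → ℝ) :
    ∑ h : α × β → Bool, bW p h * ∏ a, φ a (univ.filter (fun b => h (a, b) = true)).card =
    ∏ a, ∑ k ∈ range (Fintype.card β + 1),
      ((Fintype.card β).choose k : ℝ) * p ^ k * (1 - p) ^ (Fintype.card β - k) * φ a k := by
  simp only [← bW_count (ι := β)]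
  rw [Finset.prod_univ_sum, Fintype.piFinset_univ]
  refine Fintype.sum_equiv (Equiv.curry α β Bool) _ _ fun h => ?_
  rw [Finset.prod_mul_distrib]
  congr 1
  unfold bW
  rw [Fintype.prod_prod_type]
  rfl

noncomputable def gOf {V : Type*} (f : Sym2 V → Bool) : SimpleGraph V :=
  SimpleGraph.fromEdgeSet {e | f e = true}

lemma gOf_adj {V : Type*} (f : Sym2 V → Bool) (a b : V) :
    (gOf f).Adj a b ↔ f s(a, b) = true ∧ a ≠ b := by
  simp [gOf]

lemma gOf_fiber (n : ℕ) (p : ℝ) (G : SimpleGraph (Fin n)) :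
    ∑ f : Sym2 (Fin n) → Bool with gOf f = G, bW p f = grWeight n p G := by
  have h1 : (univ.filter (fun f : Sym2 (Fin n) → Bool => gOf f = G)) =
      Fintype.piFinset (fun e : Sym2 (Fin n) =>
        if e.IsDiag then (univ : Finset Bool) else {decide (e ∈ G.edgeSet)}) := by
    ext f
    simp only [mem_filter, mem_univ, true_and, Fintype.mem_piFinset]
    constructor
    · rintro rfl e
      split_ifs with h
      · simp
      · simp [gOf, h]
    · intro h
      ext a b
      rw [gOf_adj]
      by_cases hab : a = b
      · simp [hab]
      · have := h s(a, b)
        simp [hab] at this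
        simp [this, hab]
  rw [h1]
  unfold bW
  rw [← Finset.prod_univ_sum (fun e : Sym2 (Fin n) =>
        if e.IsDiag then (univ : Finset Bool) else {decide (e ∈ G.edgeSet)}) (fun _ b => bw p b)]
  have h2 : ∀ e : Sym2 (Fin n), (∑ b ∈ (if e.IsDiag then (univ : Finset Bool) else
      {decide (e ∈ G.edgeSet)}), bw p b) = (if e ∈ G.edgeFinset then p else 1) *
        (if e ∈ (⊤ : SimpleGraph (Fin n)).edgeFinset \ G.edgeFinset then 1 - p else 1) := by
    intro e
    by_cases h : e.IsDiag
    · have : e ∉ G.edgeSet := fun h' => G.not_isDiag_of_mem_edgeSet h' h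
      simp [h, this, bw]
    · by_cases h' : e ∈ G.edgeSet
      · simp [h, h', bw]
      · simp [h, h', bw]
  simp only [h2]
  rw [Finset.prod_mul_distrib, Finset.prod_ite_mem, Finset.prod_ite_mem]
  simp only [univ_inter, Finset.prod_const]
  rw [Finset.card_sdiff_of_subset (SimpleGraph.edgeFinset_mono le_top),
    SimpleGraph.card_edgeFinset_top_eq_card_choose_two, Fintype.card_fin]
  rfl

lemma grPr_eq (n : ℕ) (p : ℝ) (A : Set (SimpleGraph (Fin n))) :
    grPr n p A = ∑ f : Sym2 (Fin n) → Bool, bW p f * (if gOf f ∈ A then 1 else 0) := by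
  unfold grPr
  rw [← Finset.sum_fiberwise univ (fun f : Sym2 (Fin n) → Bool => gOf f)]
  refine Finset.sum_congr rfl fun G _ => ?_
  rw [← gOf_fiber]
  by_cases h : G ∈ A
  · rw [if_pos h]
    refine Finset.sum_congr rfl fun f hf => ?_
    rw [(mem_filter.1 hf).2, if_pos h, mul_one]
  · rw [if_neg h]
    symm
    refine Finset.sum_eq_zero fun f hf => ?_
    rw [(mem_filter.1 hf).2, if_neg h, mul_zero]

lemma card_filter_sub {V : Type*} [Fintype V] (P Q : V → Prop)
    [Fintype {x : V // P x}] [DecidablePred P] [DecidablePred Q] :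
    (univ.filter (fun x : {x : V // P x} => Q x.1)).card =
      (univ.filter (fun x : V => P x ∧ Q x)).card := by
  rw [← Finset.card_map (Function.Embedding.subtype P)]
  congr 1
  ext x
  simp [and_comm]

abbrev tA (n m : ℕ) := {v : Fin n // v.val < m}
abbrev tB (n m : ℕ) := {v : Fin n // ¬ v.val < m}
abbrev tC (n m : ℕ) (v : Fin n) := {w : Fin n // w.val < m ∧ w ≠ v}

lemma card_tA (n m : ℕ) (h : m ≤ n) : Fintype.card (tA n m) = m := by
  rw [Fintype.card_subtype]
  have := Fin.card_filter_val_lt (n := n) (m := m)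
  rw [min_eq_right h] at this
  convert this

lemma card_tB (n m : ℕ) (h : m ≤ n) : Fintype.card (tB n m) = n - m := by
  have := Fintype.card_subtype_compl (fun v : Fin n => v.val < m)
  have h2 := card_tA n m h
  simp only [tA, tB] at *
  simp only [Fintype.card_fin] at this
  convert this using 1
  omega

lemma card_tC (n m : ℕ) (h : m ≤ n) (v : tA n m) : Fintype.card (tC n m v.1) = m - 1 := by
  have h2 := card_tA n m h
  rw [Fintype.card_subtype] at h2 ⊢
  have : (univ.filter (fun w : Fin n => w.val < m ∧ w ≠ v.1)) =
      (univ.filter (fun w : Fin n => w.val < m)).erase v.1 := by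
    ext w; simp [and_comm]
  rw [this, Finset.card_erase_of_mem, h2]
  simp [v.2]

noncomputable def inS (n m : ℕ) (f : Sym2 (Fin n) → Bool) (v : Fin n) : ℕ :=
  (univ.filter (fun w : tC n m v => f s(v, w.1) = true)).card

lemma deg_split (n m : ℕ) (f : Sym2 (Fin n) → Bool) (v : tA n m) :
    (gOf f).degree v.1 = inS n m f v.1 +
      (univ.filter (fun w : tB n m => f s(v.1, w.1) = true)).card := by
  rw [← SimpleGraph.card_neighborFinset_eq_degree, SimpleGraph.neighborFinset_eq_filter]
  unfold inS
  rw [card_filter_sub (fun w : Fin n => w.val < m ∧ w ≠ v.1) (fun w => f s(v.1, w) = true),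
    card_filter_sub (fun w : Fin n => ¬ w.val < m) (fun w => f s(v.1, w) = true),
    ← Finset.card_filter_add_card_filter_not (fun w : Fin n => w.val < m)]
  rw [Finset.filter_filter, Finset.filter_filter]
  congr 2
  · ext w
    simp only [gOf_adj, mem_filter, mem_univ, true_and, ne_eq]
    have : (v.1 = w) ↔ (w = v.1) := eq_comm
    tauto
  · ext w
    simp only [gOf_adj, mem_filter, mem_univ, true_and, ne_eq]
    have : (v.1 = w) → w.val < m := fun h => h ▸ v.2
    tauto

lemma binom_var (M : ℕ) (p : ℝ) :
    ∑ k ∈ range (M + 1), (M.choose k : ℝ) * p ^ k * (1 - p) ^ (M - k) * ((k : ℝ) - M * p) ^ 2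
      = M * p * (1 - p) := by
  have h := congrArg (Polynomial.eval p) (bernsteinPolynomial.variance ℝ M)
  simp only [Polynomial.eval_finsetSum, bernsteinPolynomial] at h
  simp at h
  rw [← h]
  refine Finset.sum_congr rfl fun k _ => ?_
  ring

lemma binom_sum (M : ℕ) (p : ℝ) :
    ∑ k ∈ range (M + 1), (M.choose k : ℝ) * p ^ k * (1 - p) ^ (M - k) = 1 := by
  have h := bW_count (ι := Fin M) p (fun _ => 1)
  simp only [mul_one, bW_sum, Fintype.card_fin] at h
  exact h.symm

lemma binom_nonneg {p : ℝ} (hp0 : 0 < p) (hp1 : p < 1) (M k : ℕ) :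
    0 ≤ (M.choose k : ℝ) * p ^ k * (1 - p) ^ (M - k) := by
  have : 0 < 1 - p := by linarith
  positivity

lemma binom_cheb {p : ℝ} (hp0 : 0 < p) (hp1 : p < 1) (M : ℕ) {D : ℝ} (hD : 0 < D) :
    ∑ k ∈ range (M + 1), (M.choose k : ℝ) * p ^ k * (1 - p) ^ (M - k) *
      (if D < |(k : ℝ) - M * p| then 1 else 0) ≤ M * p * (1 - p) / D ^ 2 := by
  rw [le_div_iff₀ (by positivity), ← binom_var, Finset.sum_mul]
  refine Finset.sum_le_sum fun k _ => ?_
  rw [mul_assoc]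
  refine mul_le_mul_of_nonneg_left ?_ (binom_nonneg hp0 hp1 M k)
  split_ifs with h
  · rw [one_mul, ← sq_abs ((k : ℝ) - M * p)]
    exact pow_le_pow_left₀ hD.le h.le 2
  · rw [zero_mul]; positivity

lemma jA_inj (n m : ℕ) : Function.Injective
    (fun x : tA n m × tB n m => s(x.1.1, x.2.1)) := by
  rintro ⟨⟨a, ha⟩, ⟨b, hb⟩⟩ ⟨⟨c, hc⟩, ⟨d, hd⟩⟩ h
  simp only [Sym2.eq_iff] at h
  rcases h with ⟨rfl, rfl⟩ | ⟨rfl, rfl⟩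
  · rfl
  · exact absurd ha hd

lemma jC_inj (n m : ℕ) (v : Fin n) : Function.Injective
    (fun w : tC n m v => s(v, w.1)) := by
  rintro ⟨a, ha⟩ ⟨b, hb⟩ h
  simp only [Sym2.eq_iff] at h
  ext1
  rcases h with h | h
  · exact h.2
  · exact h.2.trans h.1

noncomputable def badv (m : ℕ) (p D : ℝ) (s : ℕ) : ℝ :=
  if D < |(s : ℝ) - ((m - 1 : ℕ) : ℝ) * p| then 1 else 0

lemma exp_bad (n m : ℕ) (h : m ≤ n) {p : ℝ} (hp0 : 0 < p) (hp1 : p < 1) {D : ℝ} (hD : 0 < D)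
    (v : tA n m) :
    ∑ f : Sym2 (Fin n) → Bool, bW p f * badv m p D (inS n m f v.1) ≤
      ((m - 1 : ℕ) : ℝ) * p * (1 - p) / D ^ 2 := by
  have h1 := bW_marg p (fun w : tC n m v.1 => s(v.1, w.1)) (jC_inj n m v.1) (badv m p D)
  have h2 := binom_cheb hp0 hp1 (m - 1) hD
  rw [card_tC n m h] at h1
  unfold inS
  rw [h1]
  exact h2

noncomputable def Uf (n m : ℕ) (p D : ℝ) (d : ℕ) (f : Sym2 (Fin n) → Bool) : ℝ :=
  if ∑ v : tA n m, badv m p D (inS n m f v.1) ≤ (m : ℝ) / 2 then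
    ∏ v : tA n m, (if (gOf f).degree v.1 = d then (1 / 2 : ℝ) else 1) else 0

lemma inS_mrg (n m : ℕ) (h h' : tA n m × tB n m → Bool)
    (g : ↥(Set.range (fun x : tA n m × tB n m => s(x.1.1, x.2.1)))ᶜ → Bool) (v : tA n m) :
    inS n m (mrg _ h g) v.1 = inS n m (mrg _ h' g) v.1 := by
  unfold inS
  congr 1
  ext w
  have : s(v.1, w.1) ∉ (Set.range (fun x : tA n m × tB n m => s(x.1.1, x.2.1))) := by
    rintro ⟨⟨⟨a, ha⟩, ⟨b, hb⟩⟩, h⟩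
    simp only [Sym2.eq_iff] at h
    have h1 := v.2
    have h2 := w.2.1
    rcases h with ⟨h3, h4⟩ | ⟨h3, h4⟩
    · rw [← h4] at h2; exact hb h2
    · rw [← h4] at h1; exact hb h1
  simp only [mem_filter, mem_univ, true_and]
  rw [mrg_not _ h g _ this, mrg_not _ h' g _ this]

lemma exp_U (n m : ℕ) (hmn : m ≤ n) {p : ℝ} (hp0 : 0 < p) (hp1 : p < 1) {D π : ℝ}
    (hπ : 0 ≤ π) (d : ℕ)
    (H : ∀ s : ℕ, |(s : ℝ) - ((m - 1 : ℕ) : ℝ) * p| ≤ D → ∃ k ≤ n - m, s + k = d ∧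
      π ≤ ((n - m).choose k : ℝ) * p ^ k * (1 - p) ^ (n - m - k)) :
    ∑ f : Sym2 (Fin n) → Bool, bW p f * Uf n m p D d f ≤ Real.exp (- (π * m / 4)) := by
  rw [bW_split p _ (jA_inj n m)]
  have key : ∀ g : ↥(Set.range (fun x : tA n m × tB n m => s(x.1.1, x.2.1)))ᶜ → Bool,
      ∑ h : tA n m × tB n m → Bool, bW p h * Uf n m p D d (mrg _ h g) ≤
      Real.exp (- (π * m / 4)) := by
    intro g
    set s : tA n m → ℕ := fun v => inS n m (mrg _ (fun _ => false) g) v.1 with hs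
    have hin : ∀ (h : tA n m × tB n m → Bool) (v : tA n m),
        inS n m (mrg _ h g) v.1 = s v := fun h v => inS_mrg n m _ _ g v
    have hdeg : ∀ (h : tA n m × tB n m → Bool) (v : tA n m), (gOf (mrg _ h g)).degree v.1 =
        s v + (univ.filter (fun w : tB n m => h (v, w) = true)).card := by
      intro h v
      rw [deg_split, hin]
      congr 3
      ext w
      rw [mrg_apply _ (jA_inj n m) h g (v, w)]
    simp only [Uf, hin, hdeg]
    by_cases hZ : ∑ v : tA n m, badv m p D (s v) ≤ (m : ℝ) / 2
    · simp only [if_pos hZ]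
      rw [bW_rows p (fun (v : tA n m) k => if s v + k = d then (1 / 2 : ℝ) else 1), card_tB n m hmn]
      have hb : ∀ v : tA n m, ∑ k ∈ range (n - m + 1),
          ((n - m).choose k : ℝ) * p ^ k * (1 - p) ^ (n - m - k) *
            (if s v + k = d then (1 / 2 : ℝ) else 1) ≤
          Real.exp (- (π / 2) * (1 - badv m p D (s v))) := by
        intro v
        unfold badv
        split_ifs with hD
        · simp only [sub_self, mul_zero, Real.exp_zero]
          refine le_trans ?_ (binom_sum (n - m) p).le
          refine Finset.sum_le_sum fun k _ => ?_
          refine mul_le_of_le_one_right (binom_nonneg hp0 hp1 _ k) ?_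
          split_ifs <;> norm_num
        · obtain ⟨k, hk, hkd, hk2⟩ := H (s v) (not_lt.1 hD)
          have e1 : ∑ k ∈ range (n - m + 1),
            ((n - m).choose k : ℝ) * p ^ k * (1 - p) ^ (n - m - k) *
            (if s v + k = d then (1 / 2 : ℝ) else 1) = 1 -
            ((n - m).choose k : ℝ) * p ^ k * (1 - p) ^ (n - m - k) / 2 := by
            rw [eq_sub_iff_add_eq]
            refine Eq.trans ?_ (binom_sum (n - m) p)
            have e2 : ((n - m).choose k : ℝ) * p ^ k * (1 - p) ^ (n - m - k) / 2 =
              ∑ i ∈ range (n - m + 1), (if i = k then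
                ((n - m).choose i : ℝ) * p ^ i * (1 - p) ^ (n - m - i) / 2 else 0) := by
              rw [Finset.sum_ite_eq', if_pos (by simp; omega)]
            rw [e2, ← Finset.sum_add_distrib]
            refine Finset.sum_congr rfl fun i _ => ?_
            by_cases hik : i = k
            · subst hik; simp [hkd]; ring
            · have : ¬ (s v + i = d) := by omega
              simp [this, hik]
          rw [e1]
          have := Real.add_one_le_exp (-(π / 2) * (1 - 0))
          linarith
      refine (Finset.prod_le_prod (fun v _ => ?_) (fun v _ => hb v)).trans ?_
      · refine Finset.sum_nonneg fun k _ => mul_nonneg (binom_nonneg hp0 hp1 _ k) ?_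
        split_ifs <;> norm_num
      · rw [← Real.exp_sum, Real.exp_le_exp, ← Finset.mul_sum, Finset.sum_sub_distrib]
        simp only [sum_const, card_univ, card_tA n m hmn, nsmul_eq_mul, mul_one]
        nlinarith
    · simp only [if_neg hZ, mul_zero, sum_const_zero]
      exact (Real.exp_pos _).le
  calc _ ≤ ∑ g : ↥(Set.range (fun x : tA n m × tB n m => s(x.1.1, x.2.1)))ᶜ → Bool,
        bW p g * Real.exp (- (π * m / 4)) :=
        Finset.sum_le_sum fun g _ => mul_le_mul_of_nonneg_left (key g) (bW_nonneg hp0 hp1 g)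
    _ = _ := by rw [← Finset.sum_mul, bW_sum, one_mul]

lemma grPr_le_one (n : ℕ) {p : ℝ} (hp0 : 0 < p) (hp1 : p < 1) (A : Set (SimpleGraph (Fin n))) :
    grPr n p A ≤ 1 := by
  rw [grPr_eq]
  refine le_trans ?_ (bW_sum (ι := Sym2 (Fin n)) p).le
  refine Finset.sum_le_sum fun f _ => ?_
  refine mul_le_of_le_one_right (bW_nonneg hp0 hp1 f) ?_
  split_ifs <;> norm_num

lemma main_bound (n m : ℕ) (hm : 0 < m) (hmn : m ≤ n) {p : ℝ} (hp0 : 0 < p) (hp1 : p < 1)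
    {D π t : ℝ} (hD : 0 < D) (hπ : 0 ≤ π) (Ds : Finset ℕ)
    (H : ∀ d ∈ Ds, ∀ s : ℕ, |(s : ℝ) - ((m - 1 : ℕ) : ℝ) * p| ≤ D → ∃ k ≤ n - m, s + k = d ∧
      π ≤ ((n - m).choose k : ℝ) * p ^ k * (1 - p) ^ (n - m - k)) :
    1 - (2 * (((m - 1 : ℕ) : ℝ) * p * (1 - p) / D ^ 2) +
      Ds.card * ((2 : ℝ) ^ t * Real.exp (- (π * m / 4)))) ≤
    grPr n p {G | ∀ d ∈ Ds, t ≤ ((univ.filter (fun v : Fin n => G.degree v = d)).card : ℝ)} := by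
  set A : Set (SimpleGraph (Fin n)) :=
    {G | ∀ d ∈ Ds, t ≤ ((univ.filter (fun v : Fin n => G.degree v = d)).card : ℝ)} with hA
  have hmR : (0 : ℝ) < m := by exact_mod_cast hm
  have pw : ∀ f : Sym2 (Fin n) → Bool, 1 ≤ (if gOf f ∈ A then (1 : ℝ) else 0) +
      ((2 / m) * ∑ v : tA n m, badv m p D (inS n m f v.1) +
        ∑ d ∈ Ds, (2 : ℝ) ^ t * Uf n m p D d f) := by
    intro f
    have n1 : 0 ≤ ∑ v : tA n m, badv m p D (inS n m f v.1) := by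
      refine Finset.sum_nonneg fun v _ => ?_
      unfold badv; split_ifs <;> norm_num
    have n2 : ∀ d, 0 ≤ (2 : ℝ) ^ t * Uf n m p D d f := by
      intro d
      refine mul_nonneg (by positivity) ?_
      unfold Uf
      split_ifs
      · refine Finset.prod_nonneg fun v _ => ?_
        split_ifs <;> norm_num
      · exact le_rfl
    have n3 := Finset.sum_nonneg (s := Ds) fun d _ => n2 d
    have n4 : 0 ≤ (2 / m) * ∑ v : tA n m, badv m p D (inS n m f v.1) := by positivity
    by_cases hf : gOf f ∈ A
    · rw [if_pos hf]; linarith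
    · rw [if_neg hf]
      by_cases hZ : ∑ v : tA n m, badv m p D (inS n m f v.1) ≤ (m : ℝ) / 2
      · rw [hA, Set.mem_ofPred_eq] at hf
        push Not at hf
        obtain ⟨d, hd, hlt⟩ := hf
        have := Finset.single_le_sum (fun d _ => n2 d) hd
        suffices 1 ≤ (2 : ℝ) ^ t * Uf n m p D d f by linarith
        unfold Uf
        rw [if_pos hZ, Finset.prod_ite]
        simp only [prod_const, one_pow, mul_one]
        have hc : (univ.filter (fun v : tA n m => (gOf f).degree v.1 = d)).card ≤
            (univ.filter (fun v : Fin n => (gOf f).degree v = d)).card := by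
          rw [card_filter_sub (fun v : Fin n => v.val < m) (fun v => (gOf f).degree v = d)]
          refine Finset.card_le_card ?_
          intro v; simp
        have hc' : ((univ.filter (fun v : tA n m => (gOf f).degree v.1 = d)).card : ℝ) ≤ t :=
          le_trans (by exact_mod_cast hc) hlt.le
        rw [one_div, inv_pow, ← div_eq_mul_inv, one_le_div (by positivity), ← Real.rpow_natCast]
        exact Real.rpow_le_rpow_of_exponent_le (by norm_num) hc'
      · have : 1 ≤ (2 / m) * ∑ v : tA n m, badv m p D (inS n m f v.1) := by
          rw [div_mul_eq_mul_div, one_le_div hmR]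
          linarith [not_le.1 hZ]
        linarith
  have hsum : (1 : ℝ) ≤ grPr n p A + ((2 / m) * ∑ v : tA n m, ∑ f : Sym2 (Fin n) → Bool,
      bW p f * badv m p D (inS n m f v.1) +
      ∑ d ∈ Ds, (2 : ℝ) ^ t * ∑ f : Sym2 (Fin n) → Bool, bW p f * Uf n m p D d f) := by
    calc (1 : ℝ) = ∑ f : Sym2 (Fin n) → Bool, bW p f * 1 := by simp [bW_sum]
      _ ≤ ∑ f : Sym2 (Fin n) → Bool, bW p f * ((if gOf f ∈ A then (1 : ℝ) else 0) +
      ((2 / m) * ∑ v : tA n m, badv m p D (inS n m f v.1) +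
        ∑ d ∈ Ds, (2 : ℝ) ^ t * Uf n m p D d f)) :=
          Finset.sum_le_sum fun f _ => mul_le_mul_of_nonneg_left (pw f) (bW_nonneg hp0 hp1 f)
      _ = _ := by
        simp only [mul_add, Finset.sum_add_distrib]
        rw [grPr_eq]
        refine congrArg₂ (· + ·) ?_ (congrArg₂ (· + ·) ?_ ?_)
        · refine Finset.sum_congr rfl fun f _ => ?_
          congr
        · rw [Finset.sum_comm, Finset.mul_sum]
          refine Finset.sum_congr rfl fun f _ => ?_
          rw [← Finset.mul_sum]; ring
        · simp only [Finset.mul_sum]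
          rw [Finset.sum_comm]
          refine Finset.sum_congr rfl fun d _ => Finset.sum_congr rfl fun f _ => ?_
          ring
  have b1 : (2 / m) * ∑ v : tA n m, ∑ f : Sym2 (Fin n) → Bool,
      bW p f * badv m p D (inS n m f v.1) ≤ 2 * (((m - 1 : ℕ) : ℝ) * p * (1 - p) / D ^ 2) := by
    have := Finset.sum_le_card_nsmul (univ : Finset (tA n m)) _ _
      (fun v _ => exp_bad n m hmn hp0 hp1 hD v)
    rw [card_univ, card_tA n m hmn, nsmul_eq_mul] at this
    calc _ ≤ (2 / m) * (m * (((m - 1 : ℕ) : ℝ) * p * (1 - p) / D ^ 2)) :=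
          mul_le_mul_of_nonneg_left this (by positivity)
      _ = _ := by field_simp
  have b2 : ∑ d ∈ Ds, (2 : ℝ) ^ t * ∑ f : Sym2 (Fin n) → Bool, bW p f * Uf n m p D d f ≤
      Ds.card * ((2 : ℝ) ^ t * Real.exp (- (π * m / 4))) := by
    rw [← nsmul_eq_mul]
    refine Finset.sum_le_card_nsmul _ _ _ fun d hd => ?_
    exact mul_le_mul_of_nonneg_left (exp_U n m hmn hp0 hp1 hπ d (H d hd)) (by positivity)
  linarith

noncomputable def bb (N : ℕ) (p : ℝ) (k : ℕ) : ℝ := (N.choose k : ℝ) * p ^ k * (1 - p) ^ (N - k)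

lemma bb_symm (N : ℕ) (p : ℝ) (k : ℕ) (hk : k ≤ N) : bb N (1 - p) (N - k) = bb N p k := by
  unfold bb
  rw [Nat.choose_symm hk, Nat.sub_sub_self hk]
  ring

lemma bb_rec (N : ℕ) (p : ℝ) (k : ℕ) (hk : k < N) :
    bb N p (k + 1) * ((k + 1) * (1 - p)) = bb N p k * ((N - k) * p) := by
  unfold bb
  have h := Nat.choose_succ_right_eq N k
  have h' : (N.choose (k + 1) : ℝ) * (k + 1) = N.choose k * (N - k) := by
    rw [← Nat.cast_sub hk.le]; exact_mod_cast h
  have e : N - k = N - (k + 1) + 1 := by omega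
  rw [e, pow_succ, pow_succ]
  linear_combination (p ^ k * p * (1 - p) ^ (N - (k + 1)) * (1 - p)) * h'

lemma bb_step {p : ℝ} (hp0 : 0 < p) (hp1 : p < 1) (N k : ℕ) (hN : 0 < N) {Y : ℝ} (hY0 : 0 ≤ Y)
    (h1 : (k : ℝ) - N * p ≤ Y) (h2 : Y ≤ N * (1 - p) / 10) :
    bb N p k * Real.exp (- ((Y + 1) / (9 / 10 * N * p * (1 - p)))) ≤ bb N p (k + 1) := by
  have hq : 0 < 1 - p := by linarith
  have hNR : (0 : ℝ) < N := by exact_mod_cast hN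
  have hNq : 0 < N * (1 - p) := by positivity
  have hNk : 9 / 10 * N * (1 - p) ≤ (N : ℝ) - k := by nlinarith
  have hk : k < N := by
    have : (k : ℝ) < N := by nlinarith
    exact_mod_cast this
  set E := (Y + 1) / (9 / 10 * N * p * (1 - p)) with hE
  have hE0 : 0 ≤ E := by positivity
  have hE1 : E * (9 / 10 * N * (1 - p)) * p = Y + 1 := by
    rw [hE]; field_simp
  have hr := bb_rec N p k hk
  have hb : 0 ≤ bb N p k := binom_nonneg hp0 hp1 N k
  have hkey : ((k : ℝ) + 1) * (1 - p) ≤ Real.exp E * ((N - k) * p) := by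
    have e1 := Real.add_one_le_exp E
    have hpos : 0 ≤ ((N : ℝ) - k) * p := mul_nonneg (le_trans (by positivity) hNk) hp0.le
    have e2 : Y + 1 ≤ E * ((N - k) * p) := by
      rw [← hE1, mul_assoc]
      refine mul_le_mul_of_nonneg_left ?_ hE0
      exact mul_le_mul_of_nonneg_right hNk hp0.le
    have e3 := mul_le_mul_of_nonneg_right e1 hpos
    nlinarith
  have hk1 : 0 < ((k : ℝ) + 1) * (1 - p) := by positivity
  refine le_of_mul_le_mul_right ?_ hk1
  rw [hr, Real.exp_neg, mul_assoc]
  refine mul_le_mul_of_nonneg_left ?_ hb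
  rw [inv_mul_le_iff₀ (Real.exp_pos E)]
  exact hkey

lemma bb_walk {p : ℝ} (hp0 : 0 < p) (hp1 : p < 1) (N k : ℕ) (hN : 0 < N) {Y : ℝ} (hY0 : 0 ≤ Y)
    (h1 : (k : ℝ) - N * p ≤ Y) (i : ℕ) (h2 : Y + i ≤ N * (1 - p) / 10) :
    bb N p k * Real.exp (- ((i * (Y + 1) + (i : ℝ) ^ 2 / 2) / (9 / 10 * N * p * (1 - p)))) ≤
      bb N p (k + i) := by
  have hq : 0 < 1 - p := by linarith
  have hNR : (0 : ℝ) < N := by exact_mod_cast hN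
  have hb : 0 ≤ bb N p k := binom_nonneg hp0 hp1 N k
  induction i with
  | zero => simp
  | succ i ih =>
    push_cast at h2
    have ih' := ih (by linarith)
    have hs := bb_step hp0 hp1 N (k + i) hN (Y := Y + i) (by positivity)
      (by push_cast; linarith) (by linarith)
    rw [← add_assoc]
    refine le_trans ?_ hs
    refine le_trans ?_ (mul_le_mul_of_nonneg_right ih' (Real.exp_pos _).le)
    rw [mul_assoc (bb N p k), ← Real.exp_add]
    refine mul_le_mul_of_nonneg_left ?_ hb
    rw [Real.exp_le_exp, ← neg_add, neg_le_neg_iff, ← add_div]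
    refine div_le_div_of_nonneg_right ?_ (by positivity)
    push_cast
    nlinarith

lemma card_window (s : Finset ℕ) (a b : ℝ) (hab : a ≤ b)
    (h : ∀ k ∈ s, a ≤ (k : ℝ) ∧ (k : ℝ) ≤ b) : (s.card : ℝ) ≤ b - a + 1 := by
  rcases s.eq_empty_or_nonempty with rfl | hs
  · simp; linarith
  · have hsub : s ⊆ Finset.Icc (s.min' hs) (s.max' hs) := fun k hk =>
      Finset.mem_Icc.2 ⟨s.min'_le k hk, s.le_max' k hk⟩
    have h1 := Finset.card_le_card hsub
    rw [Nat.card_Icc] at h1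
    have h2 := (h _ (s.min'_mem hs)).1
    have h3 := (h _ (s.max'_mem hs)).2
    have h4 : s.card + s.min' hs ≤ s.max' hs + 1 := by
      have := s.min'_le _ (s.max'_mem hs)
      omega
    have h5 : (s.card : ℝ) + (s.min' hs : ℕ) ≤ (s.max' hs : ℕ) + 1 := by exact_mod_cast h4
    linarith

lemma bb_start {p : ℝ} (hp0 : 0 < p) (hp1 : p < 1) (N : ℕ) (hN : 0 < N) :
    ∃ k ≤ N, |(k : ℝ) - N * p| ≤ √N ∧ 1 / (4 * √N) ≤ bb N p k := by
  have hNR : (1 : ℝ) ≤ N := by exact_mod_cast hN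
  have hs1 : 1 ≤ √(N : ℝ) := Real.one_le_sqrt.2 hNR
  by_contra! hcon
  have hc := binom_cheb hp0 hp1 N (D := √N) (by linarith)
  rw [Real.sq_sqrt (by linarith)] at hc
  have hc2 : (N : ℝ) * p * (1 - p) / N ≤ 1 / 4 := by
    rw [div_le_iff₀ (by linarith)]
    nlinarith [sq_nonneg (p - 1 / 2)]
  have hsum := binom_sum N p
  have hle : ∑ k ∈ range (N + 1), (N.choose k : ℝ) * p ^ k * (1 - p) ^ (N - k) ≤
      ∑ k ∈ range (N + 1), ((N.choose k : ℝ) * p ^ k * (1 - p) ^ (N - k) *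
      (if √N < |(k : ℝ) - N * p| then 1 else 0) +
        (if |(k : ℝ) - N * p| ≤ √N then bb N p k else 0)) := by
    refine Finset.sum_le_sum fun k _ => ?_
    by_cases h : √N < |(k : ℝ) - N * p|
    · simp [h, not_le.2 h]
    · simp [h, not_lt.1 h, bb]
  rw [Finset.sum_add_distrib, ← Finset.sum_filter] at hle
  set s := (range (N + 1)).filter (fun k : ℕ => |(k : ℝ) - N * p| ≤ √N) with hs
  have hcard := card_window s (N * p - √N) (N * p + √N) (by linarith) (by
    intro k hk
    have := abs_le.1 (mem_filter.1 hk).2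
    constructor <;> linarith)
  have hne : s.Nonempty := by
    by_contra hne
    rw [Finset.not_nonempty_iff_eq_empty] at hne
    rw [hne] at hle
    simp only [sum_empty] at hle
    linarith
  have hlt : ∑ k ∈ s, bb N p k < s.card • (1 / (4 * √N)) := by
    rw [← Finset.sum_const]
    refine Finset.sum_lt_sum_of_nonempty hne ?_
    intro k hk
    have := mem_filter.1 hk
    exact hcon k (by have := mem_range.1 this.1; omega) this.2
  rw [nsmul_eq_mul] at hlt
  have : (s.card : ℝ) * (1 / (4 * √N)) ≤ 3 / 4 := by
    rw [mul_one_div, div_le_iff₀ (by linarith)]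
    linarith
  linarith

lemma bb_upper {p : ℝ} (hp0 : 0 < p) (hp1 : p < 1) (N k k0 : ℕ) (hN : 0 < N) {X : ℝ}
    (hX : (k : ℝ) - N * p ≤ X)
    (h1 : |(k0 : ℝ) - N * p| ≤ √N) (h2 : 1 / (4 * √N) ≤ bb N p k0) (h3 : k0 ≤ k)
    (h4 : X + 2 * √N ≤ N * (1 - p) / 10) :
    1 / (4 * √N) * Real.exp (- ((X + 2 * √N + 1) ^ 2 / (9 / 5 * N * p * (1 - p)))) ≤
      bb N p k := by
  have hq : 0 < 1 - p := by linarith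
  have hNR : (0 : ℝ) < N := by exact_mod_cast hN
  obtain ⟨i, rfl⟩ := Nat.exists_eq_add_of_le h3
  push_cast at hX
  have h1' := abs_le.1 h1
  have hs := Real.sqrt_nonneg (N : ℝ)
  have hi : (i : ℝ) ≤ X + √N := by linarith
  have hw := bb_walk hp0 hp1 N k0 hN hs h1'.2 i (by linarith)
  refine le_trans ?_ hw
  refine mul_le_mul h2 ?_ (Real.exp_pos _).le (binom_nonneg hp0 hp1 N k0)
  rw [Real.exp_le_exp, neg_le_neg_iff]
  have hi0 : (0 : ℝ) ≤ i := Nat.cast_nonneg i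
  have : (X + 2 * √N + 1) ^ 2 / (9 / 5 * N * p * (1 - p)) =
      ((X + 2 * √N + 1) ^ 2 / 2) / (9 / 10 * N * p * (1 - p)) := by
    rw [div_div]; congr 1; ring
  rw [this]
  refine div_le_div_of_nonneg_right ?_ (by positivity)
  have e1 : ((i : ℝ) + (√N + 1)) ^ 2 ≤ (X + 2 * √N + 1) ^ 2 :=
    pow_le_pow_left₀ (by positivity) (by linarith) 2
  nlinarith

lemma bb_local {p : ℝ} (hp0 : 0 < p) (hp1 : p < 1) (N k : ℕ) (hN : 0 < N) (hk : k ≤ N) {X : ℝ}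
    (hX : |(k : ℝ) - N * p| ≤ X) (h4 : X + 2 * √N ≤ N * (p * (1 - p)) / 10) :
    1 / (4 * √N) * Real.exp (- ((X + 2 * √N + 1) ^ 2 / (9 / 5 * N * p * (1 - p)))) ≤
      bb N p k := by
  have hq : 0 < 1 - p := by linarith
  have hNR : (0 : ℝ) < N := by exact_mod_cast hN
  obtain ⟨k0, hk0, h1, h2⟩ := bb_start hp0 hp1 N hN
  have hX' := abs_le.1 hX
  rcases le_total k0 k with h | h
  · refine bb_upper hp0 hp1 N k k0 hN hX'.2 h1 h2 h (h4.trans ?_)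
    have : p * (1 - p) ≤ 1 - p := by nlinarith
    nlinarith
  · have c1 : ((N - k : ℕ) : ℝ) - N * (1 - p) = -((k : ℝ) - N * p) := by
      rw [Nat.cast_sub hk]; ring
    have c2 : ((N - k0 : ℕ) : ℝ) - N * (1 - p) = -((k0 : ℝ) - N * p) := by
      rw [Nat.cast_sub hk0]; ring
    have := bb_upper hq (by linarith) N (N - k) (N - k0) hN (X := X) (by rw [c1]; linarith)
      (by rw [c2, abs_neg]; exact h1) (by rw [bb_symm N p k0 hk0]; exact h2) (by omega)
      (h4.trans (by
        have : p * (1 - p) ≤ 1 - (1 - p) := by nlinarith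
        nlinarith))
    rw [bb_symm N p k hk] at this
    convert this using 5
    ring

set_option maxHeartbeats 1000000 in
lemma core {p : ℝ} (hp0 : 0 < p) (hp1 : p < 1) (n : ℕ) (hn : 20 ≤ n)
    (c2 : 150 ≤ √(p * (1 - p)) * √(Real.log n))
    (c3 : √(Real.log n) ≤ 9 / 50 * √(p * (1 - p)) * √n) :
    1 - (5000 / Real.log n + (n + 1) *
      Real.exp ((n : ℝ) ^ ((3 : ℝ) / 10) - (n : ℝ) ^ ((7 : ℝ) / 20) / 320)) ≤
    grPr n p {G | ∀ d : ℕ,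
          ((n : ℝ) - 1) * p - Real.sqrt ((1 / 5) * n * Real.log n * p * (1 - p)) ≤ (d : ℝ) →
          (d : ℝ) ≤ ((n : ℝ) - 1) * p + Real.sqrt ((1 / 5) * n * Real.log n * p * (1 - p)) →
          (n : ℝ) ^ ((3 : ℝ) / 10) / (Real.log n) ^ 2 ≤
            ((Finset.univ.filter (fun v : Fin n => G.degree v = d)).card : ℝ)} := by
  have hq : 0 < 1 - p := by linarith
  have hpq : 0 < p * (1 - p) := by positivity
  have hnR : (20 : ℝ) ≤ n := by exact_mod_cast hn
  have hn0 : (0 : ℝ) < n := by linarith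
  have hlog1 : 1 ≤ Real.log n := by
    rw [Real.le_log_iff_exp_le hn0]
    linarith [Real.exp_one_lt_d9]
  set l := √(Real.log n) with hl
  set r := √(p * (1 - p)) with hr
  set z := √(n : ℝ) with hz
  have hl2 : l ^ 2 = Real.log n := Real.sq_sqrt (by linarith)
  have hr2 : r ^ 2 = p * (1 - p) := Real.sq_sqrt hpq.le
  have hz2 : z ^ 2 = n := Real.sq_sqrt hn0.le
  have hz1 : 1 ≤ z := Real.one_le_sqrt.2 (by linarith)
  have hr0 : 0 < r := Real.sqrt_pos.2 hpq
  have hl1 : 1 ≤ l := Real.one_le_sqrt.2 hlog1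
  set X0 := √((1 / 5) * n * Real.log n * p * (1 - p)) with hX0
  have hX0n : 0 ≤ X0 := Real.sqrt_nonneg _
  have hX0le : X0 ≤ 448 / 1000 * (r * z * l) := by
    rw [hX0]
    apply Real.sqrt_le_iff.2
    refine ⟨by positivity, ?_⟩
    have : (448 / 1000 * (r * z * l)) ^ 2 = (448 / 1000) ^ 2 * (r ^ 2 * z ^ 2 * l ^ 2) := by ring
    rw [this, hr2, hz2, hl2]
    have : 0 ≤ p * (1 - p) * n * Real.log n := by positivity
    linarith
  set m := n / 10 with hm
  set N := n - m with hN
  have hmn : m ≤ n := Nat.div_le_self n 10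
  have hm0 : 0 < m := by omega
  have hN0 : 0 < N := by omega
  have hNm : (N : ℝ) = n - m := by rw [hN, Nat.cast_sub hmn]
  have hm1 : (m : ℝ) ≤ n / 10 := by
    have : m * 10 ≤ n := by omega
    have : (m : ℝ) * 10 ≤ n := by exact_mod_cast this
    linarith
  have hm2 : (n : ℝ) / 20 ≤ m := by
    have : n ≤ 20 * m := by omega
    have : (n : ℝ) ≤ 20 * m := by exact_mod_cast this
    linarith
  have hNlo : 9 / 10 * (n : ℝ) ≤ N := by linarith
  have hNhi : (N : ℝ) ≤ n := by
    have : (0 : ℝ) ≤ m := Nat.cast_nonneg m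
    linarith
  have hNz : √(N : ℝ) ≤ z := Real.sqrt_le_sqrt hNhi
  have hNpos : (0 : ℝ) < N := by exact_mod_cast hN0
  have hNs : 0 < √(N : ℝ) := Real.sqrt_pos.2 hNpos
  set D := r * z * l / 50 with hD
  have hD0 : 0 < D := by positivity
  set X := X0 + D with hX
  have hu3 : 3 * z ≤ r * z * l / 50 := by
    have := mul_le_mul_of_nonneg_left c2 (show 0 ≤ z by linarith)
    linarith
  have hXb : X + 2 * √N + 1 ≤ 488 / 1000 * (r * z * l) := by linarith
  have hX0' : 0 ≤ X := by positivity
  have hrzl : r * z * l ≤ 9 / 50 * (n * (p * (1 - p))) := by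
    rw [← hz2, ← hr2]
    have := mul_le_mul_of_nonneg_left c3 (show 0 ≤ r * z by positivity)
    linarith
  have hX4 : X + 2 * √N ≤ N * (p * (1 - p)) / 10 := by
    have e1 := mul_le_mul_of_nonneg_right hNlo hpq.le
    have e2 : 0 ≤ (n : ℝ) * (p * (1 - p)) := by positivity
    linarith
  have hNpq : 0 ≤ (N : ℝ) * (p * (1 - p)) := by positivity
  have hXN : X ≤ N * (p * (1 - p)) / 10 := by linarith
  have hppq1 : p * (1 - p) ≤ p := by linarith [mul_pos hp0 hp0]
  have hppq2 : p * (1 - p) ≤ 1 - p := by linarith [mul_pos hq hq]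
  have hXp : X ≤ N * p := by linarith [mul_le_mul_of_nonneg_left hppq1 hNpos.le]
  have hXq : X ≤ N * (1 - p) := by linarith [mul_le_mul_of_nonneg_left hppq2 hNpos.le]
  have hNp : (N : ℝ) * p = n * p - m * p := by rw [hNm]; ring
  have hNqn : (N : ℝ) * (1 - p) ≤ n * (1 - p) := mul_le_mul_of_nonneg_right hNhi hq.le
  set π := (n : ℝ) ^ (-(13 : ℝ) / 20) / 4 with hπ
  have hπ0 : 0 ≤ π := by positivity
  have hπle : π ≤ 1 / (4 * √N) *
      Real.exp (- ((X + 2 * √N + 1) ^ 2 / (9 / 5 * N * p * (1 - p)))) := by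
    have e1 : π = 1 / (4 * z) * Real.exp (- (3 / 20 * Real.log n)) := by
      have : Real.exp (- (3 / 20 * Real.log n)) = (n : ℝ) ^ (-(3 : ℝ) / 20) := by
        rw [Real.rpow_def_of_pos hn0]; congr 1; ring
      rw [this, hπ, hz, Real.sqrt_eq_rpow]
      have h : (n : ℝ) ^ (-(13 : ℝ) / 20) = (n : ℝ) ^ (-(3 : ℝ) / 20) * (n : ℝ) ^ (-(1 / 2 : ℝ)) := by
        rw [← Real.rpow_add hn0]; norm_num
      rw [h, Real.rpow_neg hn0.le (1 / 2)]
      field_simp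
    rw [e1]
    refine mul_le_mul ?_ ?_ (Real.exp_pos _).le (by positivity)
    · exact one_div_le_one_div_of_le (by positivity) (by linarith)
    · rw [Real.exp_le_exp, neg_le_neg_iff, div_le_iff₀ (by positivity)]
      have e2 : (X + 2 * √N + 1) ^ 2 ≤ (488 / 1000 * (r * z * l)) ^ 2 :=
        pow_le_pow_left₀ (by positivity) hXb 2
      have e3 : (488 / 1000 * (r * z * l)) ^ 2 =
          (488 / 1000) ^ 2 * (n * (p * (1 - p) * Real.log n)) := by
        rw [← hr2, ← hl2, ← hz2]; ring
      have hw : 0 ≤ p * (1 - p) * Real.log n := by positivity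
      have e4 := mul_le_mul_of_nonneg_right hNlo hw
      have e5 : 0 ≤ (n : ℝ) * (p * (1 - p) * Real.log n) := by positivity
      linarith
  set t := (n : ℝ) ^ ((3 : ℝ) / 10) / (Real.log n) ^ 2 with ht
  set Ds := (range (n + 1)).filter (fun d : ℕ =>
    ((n : ℝ) - 1) * p - X0 ≤ (d : ℝ) ∧ (d : ℝ) ≤ ((n : ℝ) - 1) * p + X0) with hDs
  have hm1c : ((m - 1 : ℕ) : ℝ) = m - 1 := by
    rw [Nat.cast_sub hm0]; simp
  have hmb := main_bound n m hm0 hmn hp0 hp1 (t := t) hD0 hπ0 Ds (by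
    intro d hd s hs
    rw [hm1c] at hs
    obtain ⟨hd1, hd2, hd3⟩ := mem_filter.1 hd
    have hs' := abs_le.1 hs
    have hsd : s ≤ d := by
      have : (s : ℝ) ≤ d := by linarith
      exact_mod_cast this
    obtain ⟨k, rfl⟩ := Nat.exists_eq_add_of_le hsd
    push_cast at hd2 hd3
    have hkX : |(k : ℝ) - N * p| ≤ X := by
      rw [abs_le, hNp]
      constructor <;> linarith
    have hkN : k ≤ N := by
      have : (k : ℝ) ≤ N := by linarith [(abs_le.1 hkX).2]
      exact_mod_cast this
    exact ⟨k, hkN, rfl, hπle.trans (bb_local hp0 hp1 N k hN0 hkN hkX hX4)⟩)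
  have hset : {G : SimpleGraph (Fin n) | ∀ d ∈ Ds, t ≤
      ((univ.filter (fun v : Fin n => G.degree v = d)).card : ℝ)} =
      {G | ∀ d : ℕ, ((n : ℝ) - 1) * p - X0 ≤ (d : ℝ) → (d : ℝ) ≤ ((n : ℝ) - 1) * p + X0 →
          t ≤ ((univ.filter (fun v : Fin n => G.degree v = d)).card : ℝ)} := by
    ext G
    constructor
    · intro h d h1 h2
      refine h d (mem_filter.2 ⟨?_, h1, h2⟩)
      have : (d : ℝ) ≤ n := by linarith
      have : d ≤ n := by exact_mod_cast this
      simp; omega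
    · intro h d hd
      obtain ⟨_, h1, h2⟩ := mem_filter.1 hd
      exact h d h1 h2
  rw [hset] at hmb
  refine le_trans ?_ hmb
  have b1 : 2 * (((m - 1 : ℕ) : ℝ) * p * (1 - p) / D ^ 2) ≤ 5000 / Real.log n := by
    have : D ^ 2 = n * (p * (1 - p)) * Real.log n / 2500 := by
      rw [← hr2, ← hl2, ← hz2, hD]; ring
    rw [this, hm1c, ← mul_div_assoc, div_le_div_iff₀ (by positivity) (by positivity)]
    have hw : 0 ≤ p * (1 - p) * Real.log n := by positivity
    have := mul_nonneg hw (show 0 ≤ (n : ℝ) - m + 1 by linarith)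
    linarith
  have b2 : (Ds.card : ℝ) * ((2 : ℝ) ^ t * Real.exp (- (π * m / 4))) ≤ (n + 1) *
      Real.exp ((n : ℝ) ^ ((3 : ℝ) / 10) - (n : ℝ) ^ ((7 : ℝ) / 20) / 320) := by
    refine mul_le_mul ?_ ?_ (by positivity) (by positivity)
    · have := Finset.card_filter_le (range (n + 1)) (fun d : ℕ =>
        ((n : ℝ) - 1) * p - X0 ≤ (d : ℝ) ∧ (d : ℝ) ≤ ((n : ℝ) - 1) * p + X0)
      rw [card_range] at this
      have h' : Ds.card ≤ n + 1 := this
      exact_mod_cast h'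
    · have ht0 : 0 ≤ t := by positivity
      have htn : t ≤ (n : ℝ) ^ ((3 : ℝ) / 10) :=
        div_le_self (by positivity) (one_le_pow₀ hlog1)
      rw [Real.rpow_def_of_pos (by norm_num), ← Real.exp_add, Real.exp_le_exp]
      have hlog2 : Real.log 2 ≤ 1 := by linarith [Real.log_two_lt_d9]
      have g1 : Real.log 2 * t ≤ t := mul_le_of_le_one_left ht0 hlog2
      have g2 : (n : ℝ) ^ ((7 : ℝ) / 20) / 320 ≤ π * m / 4 := by
        have : (n : ℝ) ^ ((7 : ℝ) / 20) = (n : ℝ) ^ (-(13 : ℝ) / 20) * n := by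
          rw [← Real.rpow_add_one hn0.ne']; norm_num
        rw [this, hπ]
        have : 0 ≤ (n : ℝ) ^ (-(13 : ℝ) / 20) := by positivity
        have := mul_nonneg this (show 0 ≤ (m : ℝ) - n / 20 by linarith)
        linarith
      linarith
  linarith

lemma tail_tendsto : Tendsto (fun n : ℕ => ((n : ℝ) + 1) *
      Real.exp ((n : ℝ) ^ ((3 : ℝ) / 10) - (n : ℝ) ^ ((7 : ℝ) / 20) / 320)) atTop (nhds 0) := by
  -- bound by 2 y^20 exp(-y) with y = n^(1/20) for large n
  have hy : Tendsto (fun n : ℕ => (n : ℝ) ^ ((1 : ℝ) / 20)) atTop atTop :=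
    (tendsto_rpow_atTop (by norm_num)).comp tendsto_natCast_atTop_atTop
  have h0 : Tendsto (fun y : ℝ => 2 * (y ^ 20 * Real.exp (-y))) atTop (nhds 0) := by
    have := (Real.tendsto_pow_mul_exp_neg_atTop_nhds_zero 20).const_mul 2
    simpa using this
  refine squeeze_zero' (Eventually.of_forall fun n => by positivity) ?_ (h0.comp hy)
  filter_upwards [hy.eventually_ge_atTop 1000, eventually_ge_atTop 1] with n hn hn1
  have hn0 : (0 : ℝ) ≤ n := Nat.cast_nonneg n
  have hn1' : (1 : ℝ) ≤ n := by exact_mod_cast hn1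
  simp only [Function.comp]
  set y := (n : ℝ) ^ ((1 : ℝ) / 20) with hyd
  have e20 : y ^ 20 = n := by
    rw [hyd, ← Real.rpow_natCast, ← Real.rpow_mul hn0]; norm_num
  have e6 : (n : ℝ) ^ ((3 : ℝ) / 10) = y ^ 6 := by
    rw [hyd, ← Real.rpow_natCast, ← Real.rpow_mul hn0]; norm_num
  have e7 : (n : ℝ) ^ ((7 : ℝ) / 20) = y ^ 7 := by
    rw [hyd, ← Real.rpow_natCast, ← Real.rpow_mul hn0]; norm_num
  rw [e20, e6, e7, ← mul_assoc]
  refine mul_le_mul (by linarith) ?_ (Real.exp_pos _).le (by positivity)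
  rw [Real.exp_le_exp]
  have hy6 : y ≤ y ^ 6 := le_self_pow₀ (by linarith) (by norm_num)
  have hy60 : 0 ≤ y ^ 6 := by positivity
  have : y ^ 7 = y * y ^ 6 := by ring
  nlinarith

/-- Claim on degrees: a.a.s., for every integer `d` in
`[(n−1)p − √((1/5)n·ln n·p(1−p)), (n−1)p + √((1/5)n·ln n·p(1−p))]`, the graph `G(n,p)` has
at least `n^{3/10}/ln²n` vertices of degree exactly `d`. -/
theorem aas_many_vertices_of_each_degree (p : ℝ) (hp0 : 0 < p) (hp1 : p < 1) :
    Tendsto (fun n : ℕ =>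
        grPr n p {G | ∀ d : ℕ,
          ((n : ℝ) - 1) * p - Real.sqrt ((1 / 5) * n * Real.log n * p * (1 - p)) ≤ (d : ℝ) →
          (d : ℝ) ≤ ((n : ℝ) - 1) * p + Real.sqrt ((1 / 5) * n * Real.log n * p * (1 - p)) →
          (n : ℝ) ^ ((3 : ℝ) / 10) / (Real.log n) ^ 2 ≤
            ((Finset.univ.filter (fun v : Fin n => G.degree v = d)).card : ℝ)})
      atTop (nhds 1) := by
  have hq : 0 < 1 - p := by linarith
  have hpq : 0 < p * (1 - p) := by positivity
  have hr : 0 < √(p * (1 - p)) := Real.sqrt_pos.2 hpq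
  have hlog : Tendsto (fun n : ℕ => Real.log n) atTop atTop :=
    Real.tendsto_log_atTop.comp tendsto_natCast_atTop_atTop
  have hlow : Tendsto (fun n : ℕ => 1 - (5000 / Real.log n + ((n : ℝ) + 1) *
      Real.exp ((n : ℝ) ^ ((3 : ℝ) / 10) - (n : ℝ) ^ ((7 : ℝ) / 20) / 320))) atTop (nhds 1) := by
    have h1 : Tendsto (fun n : ℕ => 5000 / Real.log n) atTop (nhds 0) :=
      hlog.const_div_atTop 5000
    have := (h1.add tail_tendsto).const_sub 1
    simpa using this
  refine tendsto_of_tendsto_of_tendsto_of_le_of_le' hlow tendsto_const_nhds ?_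
    (Eventually.of_forall fun n => grPr_le_one n hp0 hp1 _)
  have hsl : Tendsto (fun n : ℕ => √(p * (1 - p)) * √(Real.log n)) atTop atTop :=
    (Real.tendsto_sqrt_atTop.comp hlog).const_mul_atTop hr
  have hlo := (Real.isLittleO_log_id_atTop.comp_tendsto
    (tendsto_natCast_atTop_atTop : Tendsto (fun n : ℕ => (n : ℝ)) atTop atTop)).bound (c := (9 / 50 * √(p * (1 - p))) ^ 2) (by positivity)
  filter_upwards [eventually_ge_atTop 20, hsl.eventually_ge_atTop 150, hlo] with n hn h1 h2
  refine core hp0 hp1 n hn h1 ?_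
  have hn0 : (0 : ℝ) ≤ n := Nat.cast_nonneg n
  simp only [Function.comp, id, Real.norm_eq_abs, abs_of_nonneg hn0] at h2
  refine Real.sqrt_le_iff.2 ⟨by positivity, ?_⟩
  rw [mul_pow, Real.sq_sqrt hn0]
  exact (le_abs_self _).trans h2
end

section
/- Let 0 < p < 1 be fixed and q = √(p(1−p))/2. A.a.s., the set of degrees of vertices of G(n,p) contains a full interval of integers of length at least q·√(n·ln n). Equivalently, the set of numbers of edges of (n−1)-vertex induced subgraphs of G(n,p) contains a full integer interval of that length. -/
open Classical Finset Filter

noncomputable def binw (N : ℕ) (p : ℝ) (k : ℕ) : ℝ := (N.choose k : ℝ) * p ^ k * (1 - p) ^ (N - k)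

lemma binw_nonneg {p : ℝ} (h0 : 0 < p) (h1 : p < 1) (N k : ℕ) : 0 ≤ binw N p k := by
  have : 0 < 1 - p := by linarith
  unfold binw; positivity

lemma binw_sum (p : ℝ) (N : ℕ) : ∑ k ∈ range (N + 1), binw N p k = 1 := by
  have := add_pow p (1 - p) N
  simp only [add_sub_cancel, one_pow] at this
  rw [this]
  exact Finset.sum_congr rfl fun k _ => by unfold binw; ring

lemma binw_var (p : ℝ) (N : ℕ) :
    ∑ k ∈ range (N + 1), ((k : ℝ) - N * p) ^ 2 * binw N p k = N * (p * (1 - p)) := by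
  have := congrArg (Polynomial.eval p) (bernsteinPolynomial.variance ℝ N)
  simp only [Polynomial.eval_finsetSum, bernsteinPolynomial] at this
  simp at this
  rw [← mul_assoc, ← this]
  exact Finset.sum_congr rfl fun k _ => by unfold binw; ring

lemma binw_step (p : ℝ) (N k : ℕ) (hk : k < N) :
    binw N p (k + 1) * ((k + 1 : ℝ) * (1 - p)) = binw N p k * (((N : ℝ) - k) * p) := by
  have h := Nat.choose_succ_right_eq N k
  have h' : (N.choose (k + 1) : ℝ) * (k + 1) = N.choose k * ((N : ℝ) - k) := by
    rw [← Nat.cast_sub hk.le]; exact_mod_cast h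
  unfold binw
  have e : N - k = (N - (k + 1)) + 1 := by omega
  rw [e, pow_succ, pow_succ]
  linear_combination (p ^ k * p * (1 - p) ^ (N - (k + 1)) * (1 - p)) * h'

lemma binw_up {p : ℝ} (h0 : 0 < p) (h1 : p < 1) (N k : ℕ) (c Y : ℝ)
    (hY0 : 0 ≤ Y) (hc0 : 0 ≤ c) (hc1 : c ≤ 1) (hc : Y ≤ c * (N * (p * (1 - p)))) (hkN : k < N)
    (hk : (k : ℝ) + 1 ≤ N * p + Y) :
    (1 - c) * binw N p k ≤ binw N p (k + 1) := by
  have hs := binw_step p N k hkN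
  have hb := binw_nonneg h0 h1 N k
  have q0 : 0 < 1 - p := by linarith
  have hpos : (0 : ℝ) < (k + 1 : ℝ) * (1 - p) := by positivity
  have key : (1 - c) * ((k + 1 : ℝ) * (1 - p)) ≤ ((N : ℝ) - k) * p := by
    set y : ℝ := k + 1 - N * p with hy
    have e1 : (k : ℝ) + 1 = N * p + y := by rw [hy]; ring
    have e2 : (k : ℝ) = N * p + y - 1 := by rw [hy]; ring
    rw [e1, e2]
    have hyY : y ≤ Y := by rw [hy]; linarith
    have : 0 ≤ c * (N * (p * (1 - p))) := by positivity
    rcases le_total 0 y with h | h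
    · have : 0 ≤ c * (y * (1 - p)) := by positivity
      nlinarith
    · have : (1 - c) * (y * (1 - p)) ≤ 0 := by
        apply mul_nonpos_of_nonneg_of_nonpos (by linarith)
        exact mul_nonpos_of_nonpos_of_nonneg h q0.le
      have : y * p ≤ 0 := mul_nonpos_of_nonpos_of_nonneg h h0.le
      nlinarith
  have : (1 - c) * binw N p k * ((k + 1 : ℝ) * (1 - p)) ≤ binw N p (k + 1) * ((k + 1 : ℝ) * (1 - p)) := by
    rw [hs]; nlinarith
  exact le_of_mul_le_mul_right this hpos

lemma binw_down {p : ℝ} (h0 : 0 < p) (h1 : p < 1) (N k : ℕ) (c Y : ℝ)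
    (hY0 : 0 ≤ Y) (hc0 : 0 ≤ c) (hc1 : c ≤ 1) (hc : Y ≤ c * (N * (p * (1 - p)))) (hkN : k < N)
    (hk : N * p - Y ≤ (k : ℝ)) :
    (1 - c) * binw N p (k + 1) ≤ binw N p k := by
  have hs := binw_step p N k hkN
  have hb := binw_nonneg h0 h1 N (k + 1)
  have q0 : 0 < 1 - p := by linarith
  have hkN' : (k : ℝ) < N := by exact_mod_cast hkN
  have hpos : (0 : ℝ) < ((N : ℝ) - k) * p := mul_pos (by linarith) h0
  have key : (1 - c) * (((N : ℝ) - k) * p) ≤ (k + 1 : ℝ) * (1 - p) := by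
    set y : ℝ := N * p - k with hy
    have e2 : (k : ℝ) = N * p - y := by rw [hy]; ring
    rw [e2]
    have hyY : y ≤ Y := by rw [hy]; linarith
    have : 0 ≤ c * (N * (p * (1 - p))) := by positivity
    rcases le_total 0 y with h | h
    · have : 0 ≤ c * (y * p) := by positivity
      nlinarith
    · have : (1 - c) * (y * p) ≤ 0 := by
        apply mul_nonpos_of_nonneg_of_nonpos (by linarith)
        exact mul_nonpos_of_nonpos_of_nonneg h h0.le
      have : y * (1 - p) ≤ 0 := mul_nonpos_of_nonpos_of_nonneg h q0.le
      nlinarith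
  have : (1 - c) * binw N p (k + 1) * (((N : ℝ) - k) * p) ≤ binw N p k * (((N : ℝ) - k) * p) := by
    rw [← hs]; nlinarith
  exact le_of_mul_le_mul_right this hpos

lemma binw_cheb {p : ℝ} (h0 : 0 < p) (h1 : p < 1) (N : ℕ) (Y : ℝ) (hY : 0 < Y) :
    ∑ k ∈ range (N + 1), binw N p k * (if Y < |(k : ℝ) - N * p| then 1 else 0)
      ≤ N * (p * (1 - p)) / Y ^ 2 := by
  rw [le_div_iff₀ (by positivity), ← binw_var, Finset.sum_mul]
  refine Finset.sum_le_sum fun k _ => ?_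
  have hb := binw_nonneg h0 h1 N k
  split_ifs with h
  · have : Y ^ 2 ≤ ((k : ℝ) - N * p) ^ 2 := by
      rw [← sq_abs ((k : ℝ) - N * p)]; gcongr
    nlinarith
  · simp; positivity

lemma binw_exists {p : ℝ} (h0 : 0 < p) (h1 : p < 1) (N : ℕ) (Y : ℝ) (hY : 0 < Y)
    (hV : 2 * (N * (p * (1 - p))) ≤ Y ^ 2) :
    ∃ k ≤ N, |(k : ℝ) - N * p| ≤ Y ∧ 1 / (2 * (2 * Y + 1)) ≤ binw N p k := by
  by_contra! hcon
  have hc := binw_cheb h0 h1 N Y hY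
  have h2 : N * (p * (1 - p)) / Y ^ 2 ≤ 1 / 2 := by
    rw [div_le_iff₀ (by positivity)]; linarith
  have hs := binw_sum p N
  set S := (range (N + 1)).filter (fun k : ℕ => |(k : ℝ) - N * p| ≤ Y) with hS
  have hsplit : ∑ k ∈ S, binw N p k + ∑ k ∈ range (N + 1), binw N p k * (if Y < |(k : ℝ) - N * p| then 1 else 0) = 1 := by
    refine Eq.trans ?_ hs
    rw [hS, Finset.sum_filter, ← Finset.sum_add_distrib]
    refine Finset.sum_congr rfl fun k _ => ?_
    by_cases h : Y < |(k : ℝ) - N * p|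
    · simp [h, not_le.2 h]
    · simp [h, not_lt.1 h]
  have hhalf : 1 / 2 ≤ ∑ k ∈ S, binw N p k := by linarith
  have hcard : (S.card : ℝ) ≤ 2 * Y + 1 := by
    have hsub : S ⊆ Finset.Icc ⌈N * p - Y⌉₊ ⌊N * p + Y⌋₊ := by
      intro k hk
      simp only [hS, Finset.mem_filter, abs_le] at hk
      rw [Finset.mem_Icc, Nat.ceil_le]
      exact ⟨by linarith [hk.2.1], Nat.le_floor (by linarith [hk.2.2])⟩
    have h3 := Finset.card_le_card hsub
    rw [Nat.card_Icc] at h3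
    have hf := Nat.floor_le (show 0 ≤ N * p + Y by positivity)
    have hce := Nat.le_ceil (N * p - Y)
    have h4 : S.card = 0 ∨ S.card + ⌈N * p - Y⌉₊ ≤ ⌊N * p + Y⌋₊ + 1 := by omega
    rcases h4 with h4 | h4
    · rw [h4]; push_cast; linarith
    · have : (S.card : ℝ) + (⌈N * p - Y⌉₊ : ℝ) ≤ (⌊N * p + Y⌋₊ : ℝ) + 1 := by exact_mod_cast h4
      linarith
  have hne : S.Nonempty := by
    rw [Finset.nonempty_iff_ne_empty]; intro h; rw [h] at hhalf; norm_num at hhalf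
  have hlt : ∑ k ∈ S, binw N p k < ∑ k ∈ S, 1 / (2 * (2 * Y + 1)) := by
    refine Finset.sum_lt_sum_of_nonempty hne fun k hk => ?_
    simp only [hS, Finset.mem_filter, Finset.mem_range] at hk
    exact hcon k (by omega) hk.2
  rw [Finset.sum_const, nsmul_eq_mul] at hlt
  have : (S.card : ℝ) * (1 / (2 * (2 * Y + 1))) ≤ 1 / 2 := by
    rw [mul_one_div, div_le_iff₀ (by positivity)]; linarith
  linarith

lemma binw_lower {p : ℝ} (h0 : 0 < p) (h1 : p < 1) (N : ℕ) (Y : ℝ) (hY : 0 < Y)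
    (hV : 2 * (N * (p * (1 - p))) ≤ Y ^ 2) (hYV : 10 * Y ≤ N * (p * (1 - p)))
    (j : ℕ) (hj : |(j : ℝ) - N * p| ≤ Y) :
    Real.exp (-(20 / 9 * (Y ^ 2 / (N * (p * (1 - p)))))) / (2 * (2 * Y + 1)) ≤ binw N p j := by
  set V : ℝ := N * (p * (1 - p)) with hVd
  have q0 : 0 < 1 - p := by linarith
  have hV0 : 0 < V := by linarith
  have hVp : V ≤ N * p := by
    rw [hVd]; have : 0 ≤ (N : ℝ) * p * p := by positivity
    nlinarith
  have hVq : V ≤ N * (1 - p) := by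
    rw [hVd]; have : 0 ≤ (N : ℝ) * (1 - p) * (1 - p) := by positivity
    nlinarith
  obtain ⟨k, hkN, hk, hb⟩ := binw_exists h0 h1 N Y hY hV
  set c := Y / V with hcd
  have hc0 : 0 ≤ c := by positivity
  have hc1 : c ≤ 1 / 10 := by rw [hcd, div_le_iff₀ hV0]; linarith
  have hcV : Y ≤ c * V := by rw [hcd, div_mul_cancel₀ _ hV0.ne']
  rw [abs_le] at hj hk
  have up : ∀ t : ℕ, ((k + t : ℕ) : ℝ) ≤ N * p + Y → (1 - c) ^ t * binw N p k ≤ binw N p (k + t) := by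
    intro t
    induction t with
    | zero => simp
    | succ t ih =>
      intro h
      push_cast at h
      have h' := ih (by push_cast; linarith)
      have hlt : ((k + t : ℕ) : ℝ) < N := by push_cast; nlinarith
      have := binw_up h0 h1 N (k + t) c Y hY.le hc0 (by linarith) hcV (by exact_mod_cast hlt) (by push_cast; linarith)
      rw [pow_succ]
      calc _ = (1 - c) * ((1 - c) ^ t * binw N p k) := by ring
        _ ≤ (1 - c) * binw N p (k + t) := mul_le_mul_of_nonneg_left h' (by linarith)
        _ ≤ _ := this
  have down : ∀ t : ℕ, ∀ i : ℕ, i + t = k → N * p - Y ≤ (i : ℝ) → (1 - c) ^ t * binw N p k ≤ binw N p i := by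
    intro t
    induction t with
    | zero => intro i hi _; simp at hi; simp [hi]
    | succ t ih =>
      intro i hi h
      have h' := ih (i + 1) (by omega) (by push_cast; linarith)
      have := binw_down h0 h1 N i c Y hY.le hc0 (by linarith) hcV (by omega) h
      rw [pow_succ]
      calc _ = (1 - c) * ((1 - c) ^ t * binw N p k) := by ring
        _ ≤ (1 - c) * binw N p (i + 1) := mul_le_mul_of_nonneg_left h' (by linarith)
        _ ≤ _ := this
  have main : ∃ t : ℕ, (t : ℝ) ≤ 2 * Y ∧ (1 - c) ^ t * binw N p k ≤ binw N p j := by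
    rcases le_total k j with h | h
    · obtain ⟨t, rfl⟩ := Nat.exists_eq_add_of_le h
      push_cast at hj
      exact ⟨t, by linarith, up t (by push_cast; linarith)⟩
    · obtain ⟨t, rfl⟩ := Nat.exists_eq_add_of_le h
      push_cast at hk
      exact ⟨t, by linarith, down t j rfl (by linarith)⟩
  obtain ⟨t, ht, hbt⟩ := main
  have hexp : Real.exp (-(10 / 9 * c)) ≤ 1 - c := by
    have h3 := Real.add_one_le_exp (10 / 9 * c)
    rw [Real.exp_neg, inv_le_comm₀ (Real.exp_pos _) (by linarith)]
    refine le_trans ?_ h3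
    rw [inv_le_iff_one_le_mul₀ (by linarith)]
    nlinarith
  have hpow : Real.exp (-(20 / 9 * (Y ^ 2 / V))) ≤ (1 - c) ^ t := by
    calc _ ≤ Real.exp (-(10 / 9 * c)) ^ t := by
          rw [← Real.exp_nat_mul, Real.exp_le_exp]
          have : Y ^ 2 / V = Y * c := by rw [hcd]; ring
          rw [this]
          nlinarith
      _ ≤ _ := by gcongr
  refine le_trans ?_ hbt
  rw [div_eq_mul_one_div]
  exact mul_le_mul hpow hb (by positivity) (pow_nonneg (by linarith) _)

noncomputable def bwt (p : ℝ) (b : Bool) : ℝ := if b then p else 1 - p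

noncomputable def pw {ι : Type} [Fintype ι] (p : ℝ) (r : ι → Bool) : ℝ := ∏ i, bwt p (r i)

lemma sum_prod_fun {ι κ : Type} [Fintype ι] [DecidableEq ι] [Fintype κ] (g : ι → κ → ℝ) :
    ∑ r : ι → κ, ∏ i, g i (r i) = ∏ i, ∑ j, g i j := by
  rw [Finset.prod_univ_sum, Fintype.piFinset_univ]

lemma bwt_nonneg {p : ℝ} (h0 : 0 < p) (h1 : p < 1) (b : Bool) : 0 ≤ bwt p b := by
  unfold bwt; split_ifs <;> linarith

lemma pw_nonneg {ι : Type} [Fintype ι] {p : ℝ} (h0 : 0 < p) (h1 : p < 1) (r : ι → Bool) :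
    0 ≤ pw p r := Finset.prod_nonneg fun _ _ => bwt_nonneg h0 h1 _

lemma sum_bwt (p : ℝ) : ∑ b, bwt p b = 1 := by simp [bwt]

lemma sum_pw {ι : Type} [Fintype ι] [DecidableEq ι] (p : ℝ) : ∑ r : ι → Bool, pw p r = 1 := by
  unfold pw
  rw [sum_prod_fun (fun _ b => bwt p b)]
  exact Finset.prod_eq_one fun _ _ => sum_bwt p

lemma sum_pw_ite {ι : Type} [Fintype ι] [DecidableEq ι] (p : ℝ) (P : ι → Prop) (f : ι → Bool)
    [DecidablePred P] [∀ r : ι → Bool, Decidable (∀ i, P i → r i = f i)] :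
    ∑ r : ι → Bool, pw p r * (if ∀ i, P i → r i = f i then 1 else 0)
      = ∏ i, if P i then bwt p (f i) else 1 := by
  have : ∀ r : ι → Bool, pw p r * (if ∀ i, P i → r i = f i then 1 else 0)
      = ∏ i, (bwt p (r i) * if P i → r i = f i then 1 else 0) := by
    intro r
    rw [Finset.prod_mul_distrib, pw]
    congr 1
    by_cases h : ∀ i, P i → r i = f i
    · rw [if_pos h]; symm; exact Finset.prod_eq_one fun i _ => if_pos (h i)
    · rw [if_neg h]; push Not at h
      obtain ⟨i, hi, hne⟩ := h
      symm; exact Finset.prod_eq_zero (Finset.mem_univ i) (if_neg (by simp [hi, hne]))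
  simp_rw [this]
  rw [sum_prod_fun (fun i b => bwt p b * if P i → b = f i then 1 else 0)]
  refine Finset.prod_congr rfl fun i _ => ?_
  by_cases hP : P i
  · simp [hP]
  · simp [hP, bwt]

lemma sum_pw_card {ι : Type} [Fintype ι] [DecidableEq ι] (p : ℝ) (S : Finset ι) (F : ℕ → ℝ) :
    ∑ r : ι → Bool, pw p r * F (S.filter (fun i => r i = true)).card
      = ∑ k ∈ range (S.card + 1), binw S.card p k * F k := by
  have h1 : ∀ r : ι → Bool, pw p r * F (S.filter (fun i => r i = true)).card
      = ∑ T ∈ S.powerset, pw p r * (if ∀ i, i ∈ S → r i = decide (i ∈ T) then 1 else 0) * F T.card := by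
    intro r
    rw [Finset.sum_eq_single (S.filter (fun i => r i = true))]
    · rw [if_pos]; · ring
      intro i hi; simp [hi]
    · intro T hT hne
      rw [if_neg]; · ring
      intro h; apply hne
      ext i
      rw [Finset.mem_powerset] at hT
      constructor
      · intro hi; simp [hT hi, h i (hT hi), hi]
      · intro hi; rw [Finset.mem_filter] at hi; have := h i hi.1; rw [hi.2] at this; simpa using this.symm
    · intro h; exact absurd (Finset.mem_powerset.2 (Finset.filter_subset _ _)) h
  simp_rw [h1]
  rw [Finset.sum_comm]
  have h2 : ∀ T ∈ S.powerset, ∑ r : ι → Bool, pw p r * (if ∀ i, i ∈ S → r i = decide (i ∈ T) then 1 else 0) * F T.card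
      = p ^ T.card * (1 - p) ^ (S.card - T.card) * F T.card := by
    intro T hT
    rw [Finset.mem_powerset] at hT
    rw [← Finset.sum_mul, sum_pw_ite p (fun i => i ∈ S) (fun i => decide (i ∈ T))]
    congr 1
    rw [← Finset.prod_filter]
    simp only [bwt, decide_eq_true_eq]
    rw [Finset.prod_ite, Finset.prod_const, Finset.prod_const]
    congr 2
    · congr 1; ext i; simp; exact fun h => hT h
    · rw [← Finset.card_sdiff_of_subset hT]; congr 1; ext i; simp
  rw [Finset.sum_congr rfl h2, Finset.sum_powerset_apply_card (fun k => p ^ k * (1 - p) ^ (S.card - k) * F k)]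
  refine Finset.sum_congr rfl fun k _ => ?_
  rw [nsmul_eq_mul, binw]; ring

/-- the coupled graph -/
def eb (n M : ℕ) (ω : Fin n × Fin n → Bool) (η : Fin n → Fin n → Bool) (x : Fin n × Fin n) : Bool :=
  if x.1.val < M ∧ M ≤ x.2.val then η x.1 x.2 else ω x

def gr (n M : ℕ) (ω : Fin n × Fin n → Bool) (η : Fin n → Fin n → Bool) : SimpleGraph (Fin n) where
  Adj u v := u ≠ v ∧ eb n M ω η (min u v, max u v) = true
  symm := ⟨fun u v h => ⟨h.1.symm, by rw [min_comm, max_comm]; exact h.2⟩⟩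
  loopless := ⟨fun u h => h.1 rfl⟩

lemma gr_adj (n M : ℕ) (ω : Fin n × Fin n → Bool) (η : Fin n → Fin n → Bool) (u v : Fin n) :
    (gr n M ω η).Adj u v ↔ u ≠ v ∧ eb n M ω η (min u v, max u v) = true := Iff.rfl

lemma gr_eq_iff (n M : ℕ) (ω : Fin n × Fin n → Bool) (η : Fin n → Fin n → Bool) (G : SimpleGraph (Fin n)) :
    gr n M ω η = G ↔ ∀ x : Fin n × Fin n, x.1 < x.2 → eb n M ω η x = decide (G.Adj x.1 x.2) := by
  constructor
  · rintro rfl ⟨x, y⟩ h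
    simp only at h
    rw [Bool.eq_iff_iff]
    simp [gr, h.ne, min_eq_left h.le, max_eq_right h.le]
  · intro h
    ext u v
    rcases lt_trichotomy u v with huv | huv | huv
    · have := h (u, v) huv
      simp [gr, huv.ne, min_eq_left huv.le, max_eq_right huv.le, this]
    · subst huv; simp
    · have := h (v, u) huv
      simp [gr, huv.ne', min_eq_right huv.le, max_eq_left huv.le, this, G.adj_comm]

lemma card_edge (n : ℕ) (G : SimpleGraph (Fin n)) :
    G.edgeFinset.card = ((Finset.univ : Finset (Fin n × Fin n)).filter (fun x => x.1 < x.2 ∧ G.Adj x.1 x.2)).card := by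
  symm
  refine Finset.card_bij (fun x _ => s(x.1, x.2)) ?_ ?_ ?_
  · intro x hx; simp at hx; simp [hx.2]
  · rintro ⟨a, b⟩ hx ⟨c, d⟩ hy h
    simp at hx hy h
    rcases h with h | h
    · simp [h]
    · obtain ⟨rfl, rfl⟩ := h; exact absurd hx.1 (not_lt.2 hy.1.le)
  · intro e
    induction e with
    | _ u v =>
      intro h
      simp at h
      rcases lt_or_gt_of_ne h.ne with h' | h'
      · exact ⟨(u, v), by simp [h, h'], rfl⟩
      · exact ⟨(v, u), by simp [h.symm, h'], Sym2.eq_swap⟩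

lemma weight_eq (n : ℕ) (p : ℝ) (G : SimpleGraph (Fin n)) :
    grWeight n p G = ∏ x : Fin n × Fin n, if x.1 < x.2 then bwt p (decide (G.Adj x.1 x.2)) else 1 := by
  rw [← Finset.prod_filter]
  simp only [bwt, decide_eq_true_eq]
  rw [Finset.prod_ite, Finset.prod_const, Finset.prod_const, Finset.filter_filter, Finset.filter_filter,
    ← card_edge, grWeight]
  congr 2
  have ht := card_edge n ⊤
  have ht2 := SimpleGraph.card_edgeFinset_top_eq_card_choose_two (V := Fin n)
  rw [Fintype.card_fin] at ht2
  have : n.choose 2 = (Finset.univ.filter (fun x : Fin n × Fin n => x.1 < x.2)).card := by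
    rw [← ht2]; convert ht using 3
    simp; exact fun h => h.ne
  rw [this, card_edge, ← Finset.card_filter_add_card_filter_not (s := Finset.univ.filter (fun x : Fin n × Fin n => x.1 < x.2)) (fun x => G.Adj x.1 x.2),
    Finset.filter_filter, Finset.filter_filter]
  omega

noncomputable def pw2 {n : ℕ} (p : ℝ) (η : Fin n → Fin n → Bool) : ℝ := ∏ v, pw p (η v)

lemma sum_pw2_prod {n : ℕ} (p : ℝ) (F : Fin n → (Fin n → Bool) → ℝ) :
    ∑ η : Fin n → Fin n → Bool, pw2 p η * ∏ v, F v (η v) = ∏ v, ∑ r, pw p r * F v r := by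
  rw [← sum_prod_fun]
  exact Finset.sum_congr rfl fun η _ => by rw [Finset.prod_mul_distrib]; rfl

lemma sum_pw2 {n : ℕ} (p : ℝ) : ∑ η : Fin n → Fin n → Bool, pw2 p η = 1 := by
  have := sum_pw2_prod (n := n) p (fun _ _ => 1)
  simpa [sum_pw] using this

lemma push1 (n M : ℕ) (p : ℝ) (G : SimpleGraph (Fin n)) :
    ∑ ω : Fin n × Fin n → Bool, ∑ η : Fin n → Fin n → Bool,
      pw p ω * (pw2 p η * if gr n M ω η = G then 1 else 0) = grWeight n p G := by
  have h1 : ∀ ω : Fin n × Fin n → Bool, ∀ η : Fin n → Fin n → Bool,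
      pw p ω * (pw2 p η * if gr n M ω η = G then 1 else 0)
      = (pw p ω * (if ∀ x : Fin n × Fin n, (x.1 < x.2 ∧ ¬ (x.1.val < M ∧ M ≤ x.2.val)) → ω x = decide (G.Adj x.1 x.2) then 1 else 0))
       * (pw2 p η * ∏ v, if ∀ u : Fin n, (v < u ∧ (v.val < M ∧ M ≤ u.val)) → η v u = decide (G.Adj v u) then 1 else 0) := by
    intro ω η
    have e : (∏ v, if ∀ u : Fin n, (v < u ∧ (v.val < M ∧ M ≤ u.val)) → η v u = decide (G.Adj v u) then (1 : ℝ) else 0)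
        = if ∀ v, ∀ u : Fin n, (v < u ∧ (v.val < M ∧ M ≤ u.val)) → η v u = decide (G.Adj v u) then 1 else 0 := by
      split_ifs with h
      · exact Finset.prod_eq_one fun v _ => if_pos (h v)
      · rw [not_forall] at h
        obtain ⟨v, hv⟩ := h
        exact Finset.prod_eq_zero (Finset.mem_univ v) (if_neg hv)
    have e2 : gr n M ω η = G ↔ (∀ x : Fin n × Fin n, (x.1 < x.2 ∧ ¬ (x.1.val < M ∧ M ≤ x.2.val)) → ω x = decide (G.Adj x.1 x.2)) ∧ (∀ v, ∀ u : Fin n, (v < u ∧ (v.val < M ∧ M ≤ u.val)) → η v u = decide (G.Adj v u)) := by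
      rw [gr_eq_iff]
      constructor
      · intro h
        refine ⟨fun x hx => ?_, fun v u hx => ?_⟩
        · have := h x hx.1; rw [eb, if_neg hx.2] at this; exact this
        · have := h (v, u) hx.1; rw [eb, if_pos hx.2] at this; exact this
      · rintro ⟨h, h'⟩ x hx
        rw [eb]; split_ifs with hc
        · exact h' x.1 x.2 ⟨hx, hc⟩
        · exact h x ⟨hx, hc⟩
    rw [e, if_congr e2 rfl rfl, ite_and]
    split_ifs <;> ring
  simp_rw [h1, ← Finset.mul_sum]
  rw [← Finset.sum_mul, sum_pw_ite p (fun x : Fin n × Fin n => x.1 < x.2 ∧ ¬ (x.1.val < M ∧ M ≤ x.2.val)) (fun x => decide (G.Adj x.1 x.2))]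
  rw [sum_pw2_prod p (fun v r => if ∀ u : Fin n, (v < u ∧ (v.val < M ∧ M ≤ u.val)) → r u = decide (G.Adj v u) then 1 else 0)]
  have h2 : ∀ v : Fin n, _ := fun v => sum_pw_ite p (fun u : Fin n => v < u ∧ (v.val < M ∧ M ≤ u.val)) (fun u => decide (G.Adj v u))
  simp_rw [h2]
  rw [weight_eq, Fintype.prod_prod_type, Fintype.prod_prod_type, ← Finset.prod_mul_distrib]
  refine Finset.prod_congr rfl fun v _ => ?_
  rw [← Finset.prod_mul_distrib]
  refine Finset.prod_congr rfl fun u _ => ?_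
  by_cases ha : v < u <;> by_cases hb : (v.val < M ∧ M ≤ u.val) <;> simp [ha, hb]

lemma push (n M : ℕ) (p : ℝ) (A : Set (SimpleGraph (Fin n))) :
    grPr n p A = ∑ ω : Fin n × Fin n → Bool, ∑ η : Fin n → Fin n → Bool,
      pw p ω * (pw2 p η * if gr n M ω η ∈ A then 1 else 0) := by
  unfold grPr
  have : ∀ ω : Fin n × Fin n → Bool, ∀ η : Fin n → Fin n → Bool,
      pw p ω * (pw2 p η * if gr n M ω η ∈ A then 1 else 0) = ∑ G : SimpleGraph (Fin n),
        (if G ∈ A then pw p ω * (pw2 p η * if gr n M ω η = G then 1 else 0) else 0) := by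
    intro ω η
    rw [Finset.sum_eq_single (gr n M ω η)]
    · rw [if_pos (rfl : gr n M ω η = gr n M ω η)]; split_ifs <;> simp
    · intro G _ hne; rw [if_neg hne.symm]; simp
    · simp
  simp_rw [this]
  have sw : ∀ ω : Fin n × Fin n → Bool, ∑ η : Fin n → Fin n → Bool, ∑ G : SimpleGraph (Fin n),
        (if G ∈ A then pw p ω * (pw2 p η * if gr n M ω η = G then 1 else 0) else 0) =
      ∑ G : SimpleGraph (Fin n), ∑ η : Fin n → Fin n → Bool,
        (if G ∈ A then pw p ω * (pw2 p η * if gr n M ω η = G then 1 else 0) else 0) := fun ω => Finset.sum_comm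
  simp_rw [sw]
  rw [Finset.sum_comm]
  refine Finset.sum_congr rfl fun G _ => ?_
  split_ifs with h
  · exact (push1 n M p G).symm
  · simp

def Sv (n M : ℕ) (v : Fin n) : Finset (Fin n × Fin n) :=
  ((Finset.univ.filter (fun u : Fin n => u.val < M)).erase v).image (fun u => (min v u, max v u))

lemma mm_inj {n : ℕ} (v : Fin n) : Function.Injective (fun u : Fin n => (min v u, max v u)) := by
  intro a b h
  simp only [Prod.mk.injEq] at h
  rcases le_total v a with h1 | h1 <;> rcases le_total v b with h2 | h2 <;>
    simp [h1, h2] at h <;> first | exact h | (obtain ⟨h3, h4⟩ := h; omega)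

lemma card_low (n M : ℕ) (hM : M ≤ n) : (Finset.univ.filter (fun u : Fin n => u.val < M)).card = M := by
  rw [Fin.card_filter_val_lt]; omega

lemma card_high (n M : ℕ) (hM : M ≤ n) : (Finset.univ.filter (fun u : Fin n => M ≤ u.val)).card = n - M := by
  have := Finset.card_filter_add_card_filter_not (s := (Finset.univ : Finset (Fin n))) (fun u : Fin n => u.val < M)
  rw [card_low n M hM] at this
  simp only [not_lt, Finset.card_univ, Fintype.card_fin] at this
  omega

lemma card_Sv (n M : ℕ) (hM : M ≤ n) (v : Fin n) (hv : v.val < M) : (Sv n M v).card = M - 1 := by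
  rw [Sv, Finset.card_image_of_injective _ (mm_inj v), Finset.card_erase_of_mem (by simp [hv]), card_low n M hM]

def dA (n M : ℕ) (ω : Fin n × Fin n → Bool) (v : Fin n) : ℕ := ((Sv n M v).filter (fun x => ω x = true)).card

lemma deg_gr (n M : ℕ) (ω : Fin n × Fin n → Bool) (η : Fin n → Fin n → Bool) (v : Fin n) (hv : v.val < M) :
    (gr n M ω η).degree v = dA n M ω v +
      ((Finset.univ.filter (fun u : Fin n => M ≤ u.val)).filter (fun u => η v u = true)).card := by
  rw [← SimpleGraph.card_neighborFinset_eq_degree, ← Finset.card_filter_add_card_filter_not (fun u : Fin n => u.val < M)]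
  congr 1
  · rw [dA, Sv, Finset.filter_image, Finset.card_image_of_injective _ (mm_inj v)]
    congr 1
    ext u
    simp only [Finset.mem_filter, SimpleGraph.mem_neighborFinset, gr_adj, Finset.mem_erase, Finset.mem_univ, true_and]
    constructor
    · rintro ⟨⟨h1, h2⟩, h3⟩
      refine ⟨⟨h1.symm, h3⟩, ?_⟩
      rw [eb, if_neg] at h2
      · exact h2
      · rintro ⟨_, h⟩
        rcases le_total v u with h' | h'
        · simp [h'] at h; omega
        · simp [h'] at h; omega
    · rintro ⟨⟨h1, h3⟩, h2⟩
      refine ⟨⟨h1.symm, ?_⟩, h3⟩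
      rw [eb, if_neg]
      · exact h2
      · rintro ⟨_, h⟩
        rcases le_total v u with h' | h'
        · simp [h'] at h; omega
        · simp [h'] at h; omega
  · congr 1
    ext u
    simp only [Finset.mem_filter, SimpleGraph.mem_neighborFinset, gr_adj, Finset.mem_univ, true_and, not_lt]
    constructor
    · rintro ⟨⟨h1, h2⟩, h3⟩
      have h : v ≤ u := by rw [Fin.le_def]; omega
      rw [min_eq_left h, max_eq_right h, eb, if_pos ⟨hv, h3⟩] at h2
      exact ⟨h3, h2⟩
    · rintro ⟨h3, h2⟩
      have h : v < u := by rw [Fin.lt_def]; omega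
      refine ⟨⟨h.ne, ?_⟩, h3⟩
      rw [min_eq_left h.le, max_eq_right h.le, eb, if_pos ⟨hv, h3⟩]
      exact h2

noncomputable def badS (n M : ℕ) (p D : ℝ) (ω : Fin n × Fin n → Bool) : Finset (Fin n) :=
  (Finset.univ.filter (fun u : Fin n => u.val < M)).filter
    (fun v => D < |(dA n M ω v : ℝ) - ((M - 1 : ℕ) : ℝ) * p|)

lemma bad_prob (n M : ℕ) (hM : M ≤ n) (hM0 : 0 < M) {p : ℝ} (h0 : 0 < p) (h1 : p < 1) (D : ℝ) (hD : 0 < D) :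
    ∑ ω : Fin n × Fin n → Bool, pw p ω * (if M < 2 * (badS n M p D ω).card then 1 else 0)
      ≤ 2 * (((M - 1 : ℕ) : ℝ) * (p * (1 - p)) / D ^ 2) := by
  have hMr : (0 : ℝ) < M := by exact_mod_cast hM0
  have h2 : ∀ ω : Fin n × Fin n → Bool, pw p ω * (if M < 2 * (badS n M p D ω).card then (1 : ℝ) else 0)
      ≤ ∑ v ∈ Finset.univ.filter (fun u : Fin n => u.val < M), 2 / (M : ℝ) *
        (pw p ω * (if D < |(((((Sv n M v).filter (fun x => ω x = true)).card : ℕ) : ℝ)) - ((M - 1 : ℕ) : ℝ) * p| then 1 else 0)) := by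
    intro ω
    rw [← Finset.mul_sum, ← Finset.mul_sum]
    have hw := pw_nonneg h0 h1 ω
    have : (if M < 2 * (badS n M p D ω).card then (1 : ℝ) else 0) ≤ 2 / (M : ℝ) * (badS n M p D ω).card := by
      split_ifs with h
      · have : (M : ℝ) < 2 * (badS n M p D ω).card := by exact_mod_cast h
        rw [div_mul_eq_mul_div, le_div_iff₀ hMr]; linarith
      · positivity
    have e : ((badS n M p D ω).card : ℝ) = ∑ v ∈ Finset.univ.filter (fun u : Fin n => u.val < M),
        (if D < |(((((Sv n M v).filter (fun x => ω x = true)).card : ℕ) : ℝ)) - ((M - 1 : ℕ) : ℝ) * p| then (1 : ℝ) else 0) := by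
      rw [badS, Finset.card_filter]; push_cast; rfl
    rw [← e]
    calc _ ≤ pw p ω * (2 / (M : ℝ) * (badS n M p D ω).card) := mul_le_mul_of_nonneg_left this hw
      _ = _ := by ring
  refine (Finset.sum_le_sum fun ω _ => h2 ω).trans ?_
  rw [Finset.sum_comm]
  have h3 : ∀ v ∈ Finset.univ.filter (fun u : Fin n => u.val < M),
      ∑ ω : Fin n × Fin n → Bool, 2 / (M : ℝ) *
        (pw p ω * (if D < |(((((Sv n M v).filter (fun x => ω x = true)).card : ℕ) : ℝ)) - ((M - 1 : ℕ) : ℝ) * p| then 1 else 0))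
      ≤ 2 / (M : ℝ) * (((M - 1 : ℕ) : ℝ) * (p * (1 - p)) / D ^ 2) := by
    intro v hv
    rw [← Finset.mul_sum]
    have hv' : v.val < M := by simpa using hv
    have hl := sum_pw_card p (Sv n M v) (fun k => if D < |(k : ℝ) - ((M - 1 : ℕ) : ℝ) * p| then 1 else 0)
    rw [hl, card_Sv n M hM v hv']
    gcongr
    exact binw_cheb h0 h1 (M - 1) D hD
  refine (Finset.sum_le_sum h3).trans ?_
  rw [Finset.sum_const, card_low n M hM, nsmul_eq_mul]
  apply le_of_eq; field_simp

lemma row_bound (n M : ℕ) (hM : M ≤ n) {p : ℝ} (t d : ℕ) (htd : t ≤ d) (hdn : d - t ≤ n - M) :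
    ∑ r : Fin n → Bool, pw p r *
      (if t + ((Finset.univ.filter (fun u : Fin n => M ≤ u.val)).filter (fun u => r u = true)).card ≠ d then 1 else 0)
     = 1 - binw (n - M) p (d - t) := by
  have hl := sum_pw_card p (Finset.univ.filter (fun u : Fin n => M ≤ u.val)) (fun k => if t + k ≠ d then 1 else 0)
  have hs1 := binw_sum p (n - M)
  rw [← Finset.sum_erase_add (range (n - M + 1)) (fun k => binw (n - M) p k) (show d - t ∈ range (n - M + 1) by simp; omega)] at hs1
  rw [hl, card_high n M hM, eq_sub_iff_add_eq,
    ← Finset.sum_erase_add (range (n - M + 1)) _ (show d - t ∈ range (n - M + 1) by simp; omega)]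
  rw [if_neg (by omega), mul_zero, add_zero]
  refine Eq.trans ?_ hs1
  congr 1
  refine Finset.sum_congr rfl fun k hk => ?_
  rw [Finset.mem_erase] at hk
  rw [if_pos (by omega), mul_one]

lemma cond_bound (n M : ℕ) (hM : M ≤ n) {p : ℝ} (h0 : 0 < p) (h1 : p < 1) (D β : ℝ) (hβ : 0 < β) (d : ℕ)
    (hb : ∀ t : ℕ, |(t : ℝ) - ((M - 1 : ℕ) : ℝ) * p| ≤ D → t ≤ d ∧ β ≤ binw (n - M) p (d - t))
    (ω : Fin n × Fin n → Bool) (hω : ¬ M < 2 * (badS n M p D ω).card) :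
    ∑ η : Fin n → Fin n → Bool, pw2 p η * (if ∀ v : Fin n, (gr n M ω η).degree v ≠ d then 1 else 0)
      ≤ Real.exp (-(β * (M / 2))) := by
  set low := Finset.univ.filter (fun u : Fin n => u.val < M) with hlow
  have hpw2 : ∀ η : Fin n → Fin n → Bool, 0 ≤ pw2 p η := fun η =>
    Finset.prod_nonneg fun _ _ => pw_nonneg h0 h1 _
  have e1 : ∑ η : Fin n → Fin n → Bool, pw2 p η * (if ∀ v : Fin n, (gr n M ω η).degree v ≠ d then 1 else 0)
      ≤ ∑ η : Fin n → Fin n → Bool, pw2 p η * ∏ v : Fin n, (if v.val < M → dA n M ω v + ((Finset.univ.filter (fun u : Fin n => M ≤ u.val)).filter (fun u => η v u = true)).card ≠ d then 1 else 0) := by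
    refine Finset.sum_le_sum fun η _ => mul_le_mul_of_nonneg_left ?_ (hpw2 η)
    split_ifs with h
    · rw [Finset.prod_eq_one]
      intro v _
      rw [if_pos]
      intro hv
      rw [← deg_gr n M ω η v hv]; exact h v
    · exact Finset.prod_nonneg fun v _ => by split_ifs <;> norm_num
  refine e1.trans ?_
  rw [sum_pw2_prod p (fun v r => if v.val < M → dA n M ω v + ((Finset.univ.filter (fun u : Fin n => M ≤ u.val)).filter (fun u => r u = true)).card ≠ d then 1 else 0)]
  set good := low \ badS n M p D ω with hgood
  have e2 : ∏ v : Fin n, ∑ r : Fin n → Bool, pw p r * (if v.val < M → dA n M ω v + ((Finset.univ.filter (fun u : Fin n => M ≤ u.val)).filter (fun u => r u = true)).card ≠ d then 1 else 0)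
     ≤ ∏ v : Fin n, if v ∈ good then Real.exp (-β) else 1 := by
    refine Finset.prod_le_prod (fun v _ => Finset.sum_nonneg fun r _ => mul_nonneg (pw_nonneg h0 h1 r) (by split_ifs <;> norm_num)) fun v _ => ?_
    split_ifs with hv
    · rw [hgood, Finset.mem_sdiff] at hv
      have hvM : v.val < M := by simpa [hlow] using hv.1
      have hdev := hb (dA n M ω v) (not_lt.1 fun h => hv.2 (Finset.mem_filter.2 ⟨hv.1, h⟩))
      have hle : d - dA n M ω v ≤ n - M := by
        by_contra hgt
        have : binw (n - M) p (d - dA n M ω v) = 0 := by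
          rw [binw, Nat.choose_eq_zero_of_lt (by omega)]; simp
        linarith [hdev.2]
      have hr := row_bound n M hM (p := p) (dA n M ω v) d hdev.1 hle
      simp only [hvM, true_imp_iff]
      rw [hr]
      linarith [Real.add_one_le_exp (-β), hdev.2]
    · refine le_of_le_of_eq ?_ (sum_pw (ι := Fin n) p)
      refine Finset.sum_le_sum fun r _ => ?_
      have := pw_nonneg h0 h1 r
      split_ifs <;> linarith
  refine e2.trans ?_
  rw [← Finset.prod_filter, Finset.prod_const, ← Real.exp_nat_mul, Real.exp_le_exp]
  have e3 : Finset.univ.filter (fun v => v ∈ good) = good := by ext; simp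
  rw [e3]
  have hsub : badS n M p D ω ⊆ low := Finset.filter_subset _ _
  have hc : good.card = M - (badS n M p D ω).card := by
    rw [hgood, Finset.card_sdiff_of_subset hsub, hlow, card_low n M hM]
  have hc2 : M ≤ 2 * good.card := by omega
  have : (M : ℝ) ≤ 2 * good.card := by exact_mod_cast hc2
  nlinarith

lemma combine (n M : ℕ) (hM : M ≤ n) (hM0 : 0 < M) {p : ℝ} (h0 : 0 < p) (h1 : p < 1) (D β : ℝ) (hD : 0 < D)
    (hβ : 0 < β) (a m : ℕ)
    (hb : ∀ d : ℕ, a ≤ d → d ≤ a + m → ∀ t : ℕ, |(t : ℝ) - ((M - 1 : ℕ) : ℝ) * p| ≤ D →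
      t ≤ d ∧ β ≤ binw (n - M) p (d - t))
    (A : Set (SimpleGraph (Fin n)))
    (hA : ∀ G : SimpleGraph (Fin n), (∀ d : ℕ, a ≤ d → d ≤ a + m → ∃ v : Fin n, G.degree v = d) → G ∈ A) :
    1 - (2 * (((M - 1 : ℕ) : ℝ) * (p * (1 - p)) / D ^ 2) + (m + 1) * Real.exp (-(β * (M / 2)))) ≤ grPr n p A
    ∧ grPr n p A ≤ 1 := by
  have hpw2 : ∀ η : Fin n → Fin n → Bool, 0 ≤ pw2 p η := fun η =>
    Finset.prod_nonneg fun _ _ => pw_nonneg h0 h1 _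
  have tot : ∑ ω : Fin n × Fin n → Bool, ∑ η : Fin n → Fin n → Bool, pw p ω * pw2 p η = 1 := by
    simp_rw [← Finset.mul_sum, sum_pw2, mul_one]; exact sum_pw p
  rw [push n M p A]
  constructor
  · have hpt : ∀ ω : Fin n × Fin n → Bool,
        ∑ η : Fin n → Fin n → Bool, pw p ω * pw2 p η
        ≤ (∑ η : Fin n → Fin n → Bool, pw p ω * (pw2 p η * if gr n M ω η ∈ A then 1 else 0))
          + (pw p ω * (if M < 2 * (badS n M p D ω).card then 1 else 0)
            + pw p ω * ((m + 1) * Real.exp (-(β * (M / 2))))) := by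
      intro ω
      rw [← Finset.mul_sum, ← Finset.mul_sum, ← mul_add, ← mul_add]
      refine mul_le_mul_of_nonneg_left ?_ (pw_nonneg h0 h1 ω)
      by_cases hω : M < 2 * (badS n M p D ω).card
      · rw [if_pos hω, sum_pw2]
        have : 0 ≤ ∑ η : Fin n → Fin n → Bool, pw2 p η * (if gr n M ω η ∈ A then 1 else 0) :=
          Finset.sum_nonneg fun η _ => mul_nonneg (hpw2 η) (by split_ifs <;> norm_num)
        have : 0 ≤ ((m : ℝ) + 1) * Real.exp (-(β * (M / 2))) := by positivity
        linarith
      · rw [if_neg hω, zero_add]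
        have h2 : ∑ d ∈ Finset.Icc a (a + m), ∑ η : Fin n → Fin n → Bool, pw2 p η * (if ∀ v : Fin n, (gr n M ω η).degree v ≠ d then (1 : ℝ) else 0)
            ≤ (m + 1) * Real.exp (-(β * (M / 2))) := by
          refine (Finset.sum_le_sum fun d hd => cond_bound n M hM h0 h1 D β hβ d (hb d (Finset.mem_Icc.1 hd).1 (Finset.mem_Icc.1 hd).2) ω hω).trans ?_
          rw [Finset.sum_const, Nat.card_Icc, nsmul_eq_mul]
          have : a + m + 1 - a = m + 1 := by omega
          rw [this]; push_cast; exact le_rfl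
        refine le_trans ?_ (add_le_add_right h2 _)
        rw [Finset.sum_comm, ← Finset.sum_add_distrib]
        refine Finset.sum_le_sum fun η _ => ?_
        rw [← Finset.mul_sum, ← mul_add]
        refine le_mul_of_one_le_right (hpw2 η) ?_
        by_cases hg : gr n M ω η ∈ A
        · rw [if_pos hg]
          have : 0 ≤ ∑ d ∈ Finset.Icc a (a + m), (if ∀ v : Fin n, (gr n M ω η).degree v ≠ d then (1 : ℝ) else 0) :=
            Finset.sum_nonneg fun d _ => by split_ifs <;> norm_num
          linarith
        · have : ∃ d, a ≤ d ∧ d ≤ a + m ∧ ∀ v : Fin n, (gr n M ω η).degree v ≠ d := by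
            by_contra! hcon
            exact hg (hA _ hcon)
          obtain ⟨d, hd1, hd2, hd⟩ := this
          rw [if_neg hg, zero_add]
          refine le_trans ?_ (Finset.single_le_sum (fun d _ => by split_ifs <;> norm_num) (Finset.mem_Icc.2 ⟨hd1, hd2⟩))
          rw [if_pos hd]
    have hs := Finset.sum_le_sum fun ω (_ : ω ∈ Finset.univ) => hpt ω
    rw [tot, Finset.sum_add_distrib, Finset.sum_add_distrib, ← Finset.sum_mul, sum_pw, one_mul] at hs
    linarith [bad_prob n M hM hM0 h0 h1 D hD]
  · refine le_of_le_of_eq ?_ tot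
    refine Finset.sum_le_sum fun ω _ => Finset.sum_le_sum fun η _ => ?_
    refine mul_le_mul_of_nonneg_left ?_ (pw_nonneg h0 h1 ω)
    have := hpw2 η
    split_ifs <;> linarith

lemma le_sq_aux {a b : ℝ} (h : a ^ 2 ≤ b ^ 2) (hb : 0 ≤ b) : a ≤ b :=
  (abs_le_of_sq_le_sq h hb).trans' (le_abs_self a)

lemma bin_asym {p : ℝ} (h0 : 0 < p) (h1 : p < 1) (n N : ℕ) (L s σ : ℝ) (hN1 : N ≤ n) (hN2 : n ≤ 2 * N)
    (hσ0 : 0 < σ) (hσ : σ ^ 2 = p * (1 - p)) (hs0 : 0 < s) (hs : s ^ 2 = n * L)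
    (hL : 6400 ≤ σ ^ 2 * L) (hn : (n : ℝ) = Real.exp L) (j : ℕ) (hj : |(j : ℝ) - N * p| ≤ 3 / 10 * (σ * s)) :
    Real.exp (-(95 / 100 * L)) ≤ binw N p j := by
  have hσh : σ ^ 2 ≤ 1 / 4 := by rw [hσ]; nlinarith [sq_nonneg (p - 1 / 2)]
  have hσh' : σ ≤ 1 / 2 := by nlinarith
  have hLpos : 0 < L := by
    by_contra h
    have := mul_nonpos_of_nonneg_of_nonpos (sq_nonneg σ) (not_lt.1 h)
    linarith
  have hL0 : 25600 ≤ L := by nlinarith [sq_nonneg σ]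
  have hq : ∀ x : ℝ, 0 ≤ x → x ^ 2 / 2 ≤ Real.exp x := fun x hx => by
    have := Real.quadratic_le_exp_of_nonneg hx; linarith
  have hN1' : (N : ℝ) ≤ n := by exact_mod_cast hN1
  have hN2' : (n : ℝ) ≤ 2 * N := by exact_mod_cast hN2
  have hnpos : (0 : ℝ) < n := by rw [hn]; exact Real.exp_pos _
  have hNpos : (0 : ℝ) < N := by linarith
  have hnL : L ^ 2 / 2 ≤ n := by rw [hn]; exact hq L (by linarith)
  have hsn : s ≤ σ * n / 6 := by
    refine le_sq_aux ?_ (by positivity)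
    rw [hs]
    have : 36 * L ≤ σ ^ 2 * n := by
      have : σ ^ 2 * (L ^ 2 / 2) ≤ σ ^ 2 * n := by gcongr
      nlinarith
    nlinarith
  have hlow := binw_lower h0 h1 N (3 / 10 * (σ * s)) (by positivity)
    (by rw [← hσ]
        have : (3 / 10 * (σ * s)) ^ 2 = 9 / 100 * σ ^ 2 * (n * L) := by rw [← hs]; ring
        rw [this]
        have : σ ^ 2 * (n * 25600) ≤ σ ^ 2 * (n * L) := by gcongr
        have : σ ^ 2 * N ≤ σ ^ 2 * n := by gcongr
        have : 0 ≤ σ ^ 2 * n := by positivity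
        nlinarith)
    (by rw [← hσ]
        have : σ * s ≤ σ * (σ * n / 6) := by gcongr
        have : σ ^ 2 * n ≤ σ ^ 2 * (2 * N) := by gcongr
        nlinarith) j hj
  refine le_trans ?_ hlow
  rw [le_div_iff₀ (by positivity)]
  have hsL : s ≤ Real.exp (55 / 100 * L) := by
    refine le_sq_aux ?_ (Real.exp_pos _).le
    rw [hs, ← Real.exp_nat_mul, hn]
    have : L ≤ Real.exp (1 / 10 * L) := by
      refine le_trans ?_ (hq (1 / 10 * L) (by linarith)); nlinarith
    calc Real.exp L * L ≤ Real.exp L * Real.exp (1 / 10 * L) := by gcongr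
      _ = _ := by rw [← Real.exp_add]; congr 1; push_cast; ring
  have hs5 : 5 ≤ s := by
    have : (5 : ℝ) ^ 2 ≤ s ^ 2 := by
      rw [hs]; nlinarith
    exact le_sq_aux this hs0.le
  calc Real.exp (-(95 / 100 * L)) * (2 * (2 * (3 / 10 * (σ * s)) + 1))
      ≤ Real.exp (-(95 / 100 * L)) * Real.exp (55 / 100 * L) := by
        refine mul_le_mul_of_nonneg_left ?_ (Real.exp_pos _).le
        refine le_trans ?_ hsL
        have : σ * s ≤ 1 / 2 * s := by gcongr
        nlinarith
    _ = Real.exp (-(40 / 100 * L)) := by rw [← Real.exp_add]; congr 1; ring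
    _ ≤ _ := by
        rw [Real.exp_le_exp, neg_le_neg_iff, ← hσ]
        have : (3 / 10 * (σ * s)) ^ 2 / (N * σ ^ 2) ≤ 18 / 100 * L := by
          rw [div_le_iff₀ (by positivity)]
          have : (3 / 10 * (σ * s)) ^ 2 = 9 / 100 * σ ^ 2 * (n * L) := by rw [← hs]; ring
          rw [this]
          have : σ ^ 2 * (n * L) ≤ σ ^ 2 * (2 * N * L) := by gcongr
          nlinarith
        linarith

set_option maxHeartbeats 1600000 in
lemma main_bound_s15 {p : ℝ} (h0 : 0 < p) (h1 : p < 1) (n : ℕ)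
    (hL : 6400 ≤ p * (1 - p) * Real.log n) (A : Set (SimpleGraph (Fin n)))
    (hA : A = {G | ∃ a m : ℕ,
          (Real.sqrt (p * (1 - p)) / 2) * Real.sqrt ((n : ℝ) * Real.log n) ≤ (m : ℝ) ∧
          ∀ d : ℕ, a ≤ d → d ≤ a + m → ∃ v : Fin n, G.degree v = d}) :
    1 - 1601 / Real.log n ≤ grPr n p A ∧ grPr n p A ≤ 1 := by
  have q0 : 0 < 1 - p := by linarith
  have hv0 : 0 < p * (1 - p) := by positivity
  set L := Real.log n with hLd
  have hLpos : 0 < L := by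
    by_contra h
    have := mul_nonpos_of_nonneg_of_nonpos hv0.le (not_lt.1 h)
    linarith
  have hnpos : (0 : ℝ) < n := by
    rcases Nat.eq_zero_or_pos n with h | h
    · rw [h] at hLd; simp at hLd; linarith
    · exact_mod_cast h
  have hn : (n : ℝ) = Real.exp L := (Real.exp_log hnpos).symm
  set σ := Real.sqrt (p * (1 - p)) with hσd
  have hσ0 : 0 < σ := Real.sqrt_pos.2 hv0
  have hσ : σ ^ 2 = p * (1 - p) := Real.sq_sqrt hv0.le
  set s := Real.sqrt ((n : ℝ) * L) with hsd
  have hs0 : 0 < s := Real.sqrt_pos.2 (by positivity)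
  have hs : s ^ 2 = n * L := Real.sq_sqrt (by positivity)
  rw [← hσ] at hL
  have hσh : σ ^ 2 ≤ 1 / 4 := by rw [hσ]; nlinarith [sq_nonneg (p - 1 / 2)]
  have hσh' : σ ≤ 1 / 2 := by nlinarith
  have hL0 : 25600 ≤ L := by nlinarith [sq_nonneg σ]
  have hq : ∀ x : ℝ, 0 ≤ x → x ^ 2 / 2 ≤ Real.exp x := fun x hx => by
    have := Real.quadratic_le_exp_of_nonneg hx; linarith
  have hnL : L ^ 2 / 2 ≤ n := by rw [hn]; exact hq L (by linarith)
  have hnL' : L ≤ n := by nlinarith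
  have hsn : s ≤ σ * n / 6 := by
    refine le_sq_aux ?_ (by positivity)
    rw [hs]
    have : 36 * L ≤ σ ^ 2 * n := by
      have : σ ^ 2 * (L ^ 2 / 2) ≤ σ ^ 2 * n := by gcongr
      nlinarith
    nlinarith
  have hσs : 80 ≤ σ * s := by
    refine le_sq_aux ?_ (by positivity)
    rw [mul_pow, hs]
    have : 6400 * n ≤ σ ^ 2 * L * n := by gcongr
    nlinarith
  have hσs2 : σ * s ≤ n * p / 6 := by
    have h3 : σ * s ≤ σ * (σ * n / 6) := by gcongr
    have h4 : σ ^ 2 ≤ p := by rw [hσ]; nlinarith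
    have h5 : σ ^ 2 * n ≤ p * n := by gcongr
    nlinarith
  have hn2 : 25600 ≤ n := by
    have : (25600 : ℝ) ≤ n := by linarith
    exact_mod_cast this
  set M := n / 2 with hM
  set x : ℝ := (n - 1) * p - σ * s / 4 with hx
  have hx0 : 0 ≤ x := by rw [hx]; nlinarith
  set m := ⌈σ / 2 * s⌉₊ with hm
  set a := ⌈x⌉₊ with ha
  have ha1 : x ≤ a := Nat.le_ceil x
  have ha2 : (a : ℝ) < x + 1 := Nat.ceil_lt_add_one hx0
  have hm1 : σ / 2 * s ≤ m := Nat.le_ceil _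
  have hm2 : (m : ℝ) < σ / 2 * s + 1 := Nat.ceil_lt_add_one (by positivity)
  have hMr1 : (M : ℝ) ≤ n / 2 := by rw [hM]; exact Nat.cast_div_le
  have hMr2 : 2 / 5 * (n : ℝ) ≤ M := by
    have : 2 * n ≤ 5 * M := by omega
    have : (2 : ℝ) * n ≤ 5 * M := by exact_mod_cast this
    linarith
  have hMc : ((M - 1 : ℕ) : ℝ) = M - 1 := by rw [Nat.cast_sub (by omega)]; simp
  have hNc : ((n - M : ℕ) : ℝ) = n - M := by rw [Nat.cast_sub (by omega)]
  have key := combine n M (by omega) (by omega) h0 h1 (σ * s / 40) (Real.exp (-(95 / 100 * L)))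
    (by positivity) (Real.exp_pos _) a m
    (by
      intro d hd1 hd2 t ht
      have hd1' : (a : ℝ) ≤ d := by exact_mod_cast hd1
      have hd2' : (d : ℝ) ≤ a + m := by exact_mod_cast hd2
      rw [hMc, abs_le] at ht
      have hNp : (n / 2 : ℝ) * p ≤ (n - M) * p := by gcongr; linarith
      have hreal : |((d : ℝ) - t) - (n - M : ℝ) * p| ≤ 3 / 10 * (σ * s) := by
        rw [abs_le]; constructor <;> linarith [ht.1, ht.2, hx]
      have htd : t ≤ d := by
        have : (t : ℝ) ≤ d := by
          rw [abs_le] at hreal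
          linarith [hreal.1]
        exact_mod_cast this
      refine ⟨htd, bin_asym h0 h1 n (n - M) L s σ (by omega) (by omega) hσ0 hσ hs0 hs hL hn _ ?_⟩
      rw [hNc, Nat.cast_sub htd]; exact hreal)
    A
    (by intro G hG; rw [hA]; exact ⟨a, m, hm1, hG⟩)
  refine ⟨le_trans ?_ key.1, key.2⟩
  have e1 : 2 * (((M - 1 : ℕ) : ℝ) * (p * (1 - p)) / (σ * s / 40) ^ 2) ≤ 1600 / L := by
    rw [← hσ, hMc, ← mul_div_assoc, div_le_div_iff₀ (by positivity) hLpos]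
    have : (σ * s / 40) ^ 2 = σ ^ 2 * (n * L) / 1600 := by rw [← hs]; ring
    rw [this]
    have : σ ^ 2 * L * (2 * (M - 1)) ≤ σ ^ 2 * L * n := by gcongr; linarith
    nlinarith
  have e2 : ((m : ℝ) + 1) * Real.exp (-(Real.exp (-(95 / 100 * L)) * (M / 2))) ≤ 1 / L := by
    have hmn : (m : ℝ) + 1 ≤ Real.exp L := by
      rw [← hn]
      have h6 : (n : ℝ) * p ≤ n := mul_le_of_le_one_right hnpos.le h1.le
      linarith
    have h5 : 2 * L ≤ Real.exp (-(95 / 100 * L)) * (M / 2) := by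
      have : Real.exp (-(95 / 100 * L)) * (1 / 5 * n) ≤ Real.exp (-(95 / 100 * L)) * (M / 2) := by
        refine mul_le_mul_of_nonneg_left ?_ (Real.exp_pos _).le
        linarith
      refine le_trans ?_ this
      have e : Real.exp (-(95 / 100 * L)) * (1 / 5 * n) = 1 / 5 * Real.exp (5 / 100 * L) := by
        rw [hn, show 5 / 100 * L = -(95 / 100 * L) + L by ring, Real.exp_add]; ring
      rw [e]
      have := hq (5 / 100 * L) (by linarith)
      nlinarith
    calc _ ≤ Real.exp L * Real.exp (-(2 * L)) := by
          refine mul_le_mul hmn ?_ (Real.exp_pos _).le (Real.exp_pos _).le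
          rw [Real.exp_le_exp]; linarith
      _ = 1 / n := by rw [← Real.exp_add, hn, one_div, ← Real.exp_neg]; congr 1; ring
      _ ≤ 1 / L := one_div_le_one_div_of_le hLpos hnL'
  have e3 : 1601 / L = 1600 / L + 1 / L := by ring
  rw [e3]; linarith


/-- With `q = √(p(1−p))/2`: a.a.s. the set of vertex degrees of `G(n,p)` contains a full
integer interval of length at least `q·√(n·ln n)`. -/
theorem aas_degrees_contain_interval (p : ℝ) (hp0 : 0 < p) (hp1 : p < 1) :
    Tendsto (fun n : ℕ =>
        grPr n p {G | ∃ a m : ℕ,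
          (Real.sqrt (p * (1 - p)) / 2) * Real.sqrt ((n : ℝ) * Real.log n) ≤ (m : ℝ) ∧
          ∀ d : ℕ, a ≤ d → d ≤ a + m → ∃ v : Fin n, G.degree v = d})
      atTop (nhds 1) := by
  have q0 : 0 < 1 - p := by linarith
  have hv0 : 0 < p * (1 - p) := by positivity
  have hlog : Tendsto (fun n : ℕ => Real.log (n : ℝ)) atTop atTop :=
    Real.tendsto_log_atTop.comp tendsto_natCast_atTop_atTop
  have hev : ∀ᶠ n : ℕ in atTop, 6400 ≤ p * (1 - p) * Real.log (n : ℝ) :=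
    (hlog.const_mul_atTop hv0).eventually_ge_atTop 6400
  have hlim : Tendsto (fun n : ℕ => 1 - 1601 / Real.log (n : ℝ)) atTop (nhds 1) := by
    have := (hlog.const_div_atTop (1601 : ℝ)).const_sub 1
    simpa using this
  refine tendsto_of_tendsto_of_tendsto_of_le_of_le' hlim tendsto_const_nhds ?_ ?_
  · filter_upwards [hev] with n hn
    exact (main_bound_s15 hp0 hp1 n hn _ rfl).1
  · filter_upwards [hev] with n hn
    exact (main_bound_s15 hp0 hp1 n hn _ rfl).2
end
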